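/- Let B be an open ball of ℝ^d centered at the origin and assume φ is not identically zero. For every nonnegative continuous function f on ∂B, there exists one and only one nonnegative u ∈ C(closure of B) such that u is a distributional solution of Δ_k u = φ(u) in B and u = f on ∂B. -/

import Mathlib

open MeasureTheory Real Filter
open scoped RealInnerProductSpace ENNReal Topology

noncomputable section

abbrev E (d : ℕ) := EuclideanSpace ℝ (Fin d)

/-- The reflection σ_α in the hyperplane orthogonal to α. -/
def dunklReflect {d : ℕ} (α x : E d) : E d := x - ((2 * ⟪α, x⟫) / ‖α‖ ^ 2) • α

/-- The Euclidean Laplacian, as the trace of the second derivative. -/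
def lap {d : ℕ} (u : E d → ℝ) (x : E d) : ℝ :=
  ∑ i : Fin d, iteratedFDeriv ℝ 2 u x ![EuclideanSpace.single i 1, EuclideanSpace.single i 1]

/-- The Dunkl Laplacian Δ_k associated with the root system `R` and multiplicity `k`. -/
def dunklLap {d : ℕ} (R : Finset (E d)) (k : E d → ℝ) (u : E d → ℝ) (x : E d) : ℝ :=
  lap u x + ∑ α ∈ R, k α * (⟪gradient u x, α⟫ / ⟪α, x⟫ -
    (‖α‖ ^ 2 / 2) * ((u x - u (dunklReflect α x)) / ⟪α, x⟫ ^ 2))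

/-- The weight function w_k. -/
def wk {d : ℕ} (R : Finset (E d)) (k : E d → ℝ) (x : E d) : ℝ :=
  ∏ α ∈ R, |⟪x, α⟫| ^ (k α)

/-- `u` is a distributional solution of Δ_k u = φ(u) on `D`. -/
def IsDunklSol {d : ℕ} (R : Finset (E d)) (k : E d → ℝ) (φ : ℝ → ℝ) (D : Set (E d))
    (u : E d → ℝ) : Prop :=
  ∀ ψ : E d → ℝ, ContDiff ℝ (⊤ : ℕ∞) ψ → HasCompactSupport ψ → tsupport ψ ⊆ D →
    ∫ x in D, u x * dunklLap R k ψ x * wk R k x = ∫ x in D, φ (u x) * ψ x * wk R k x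

/-- The contribution of the root `α` to the Dunkl Laplacian. -/
def dunklTerm {d : ℕ} (α : E d) (u : E d → ℝ) (x : E d) : ℝ :=
  fderiv ℝ u x α / ⟪α, x⟫ - (‖α‖ ^ 2 / 2) * ((u x - u (dunklReflect α x)) / ⟪α, x⟫ ^ 2)

/-- The points that lie on no reflecting hyperplane. -/
def offWalls {d : ℕ} (R : Finset (E d)) : Set (E d) := {x | ∀ α ∈ R, ⟪α, x⟫ ≠ 0}

lemma dunklLap_eq {d : ℕ} (R : Finset (E d)) (k : E d → ℝ) (u : E d → ℝ) (x : E d) :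
    dunklLap R k u x = lap u x + ∑ α ∈ R, k α * dunklTerm α u x := by
  simp only [dunklLap, dunklTerm, inner_gradient_left]

lemma differentiable_fderiv_apply {d : ℕ} {u : E d → ℝ} (hu : ContDiff ℝ 2 u) (e : E d) :
    Differentiable ℝ (fun y => fderiv ℝ u y e) := by
  have h : Differentiable ℝ (fderiv ℝ u) :=
    (hu.fderiv_right (m := 1) (by norm_num)).differentiable (by norm_num)
  fun_prop

lemma lap_eq {d : ℕ} {u : E d → ℝ} (hu : ContDiff ℝ 2 u) (x : E d) :
    lap u x = ∑ i : Fin d, fderiv ℝ (fun y => fderiv ℝ u y (EuclideanSpace.single i 1)) x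
      (EuclideanSpace.single i 1) := by
  have h : Differentiable ℝ (fderiv ℝ u) :=
    (hu.fderiv_right (m := 1) (by norm_num)).differentiable (by norm_num)
  refine Finset.sum_congr rfl fun i _ => ?_
  rw [iteratedFDeriv_two_apply, fderiv_clm_apply (h x) (by fun_prop)]
  simp

lemma lap_add {d : ℕ} {u v : E d → ℝ} (hu : ContDiff ℝ 2 u) (hv : ContDiff ℝ 2 v) (x : E d) :
    lap (fun y => u y + v y) x = lap u x + lap v x := by
  have h1 : Differentiable ℝ u := hu.differentiable (by norm_num)
  have h2 : Differentiable ℝ v := hv.differentiable (by norm_num)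
  rw [lap_eq (hu.add hv), lap_eq hu, lap_eq hv, ← Finset.sum_add_distrib]
  refine Finset.sum_congr rfl fun i _ => ?_
  have e : (fun y => fderiv ℝ (fun y => u y + v y) y (EuclideanSpace.single i 1)) =
      fun y => fderiv ℝ u y (EuclideanSpace.single i 1)
        + fderiv ℝ v y (EuclideanSpace.single i 1) := by
    funext y
    rw [fderiv_fun_add (h1 y) (h2 y)]; rfl
  rw [e, fderiv_fun_add (differentiable_fderiv_apply hu _ x) (differentiable_fderiv_apply hv _ x)]
  rfl

lemma lap_const_mul {d : ℕ} {u : E d → ℝ} (c : ℝ) (hu : ContDiff ℝ 2 u) (x : E d) :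
    lap (fun y => c * u y) x = c * lap u x := by
  have h1 : Differentiable ℝ u := hu.differentiable (by norm_num)
  rw [lap_eq (contDiff_const.mul hu), lap_eq hu, Finset.mul_sum]
  refine Finset.sum_congr rfl fun i _ => ?_
  have e : (fun y => fderiv ℝ (fun y => c * u y) y (EuclideanSpace.single i 1)) =
      fun y => c * fderiv ℝ u y (EuclideanSpace.single i 1) := by
    funext y
    rw [fderiv_const_mul (h1 y)]; rfl
  rw [e, fderiv_const_mul (differentiable_fderiv_apply hu _ x)]
  rfl

lemma dunklTerm_add {d : ℕ} (α : E d) {u v : E d → ℝ} (hu : Differentiable ℝ u)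
    (hv : Differentiable ℝ v) (x : E d) :
    dunklTerm α (fun y => u y + v y) x = dunklTerm α u x + dunklTerm α v x := by
  simp only [dunklTerm]
  rw [fderiv_fun_add (hu x) (hv x)]
  simp only [add_apply]
  ring

lemma dunklTerm_const_mul {d : ℕ} (α : E d) {u : E d → ℝ} (c : ℝ) (hu : Differentiable ℝ u)
    (x : E d) : dunklTerm α (fun y => c * u y) x = c * dunklTerm α u x := by
  simp only [dunklTerm]
  rw [fderiv_const_mul (hu x)]
  simp only [smul_apply, smul_eq_mul]
  ring

lemma dunklLap_add {d : ℕ} (R : Finset (E d)) (k : E d → ℝ) {u v : E d → ℝ}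
    (hu : ContDiff ℝ 2 u) (hv : ContDiff ℝ 2 v) (x : E d) :
    dunklLap R k (fun y => u y + v y) x = dunklLap R k u x + dunklLap R k v x := by
  simp only [dunklLap_eq, lap_add hu hv, dunklTerm_add _ (hu.differentiable (by norm_num))
    (hv.differentiable (by norm_num)), mul_add, Finset.sum_add_distrib]
  ring

lemma dunklLap_const_mul {d : ℕ} (R : Finset (E d)) (k : E d → ℝ) {u : E d → ℝ} (c : ℝ)
    (hu : ContDiff ℝ 2 u) (x : E d) :
    dunklLap R k (fun y => c * u y) x = c * dunklLap R k u x := by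
  simp only [dunklLap_eq, lap_const_mul c hu, dunklTerm_const_mul _ c
    (hu.differentiable (by norm_num)), mul_add, Finset.mul_sum]
  congr 1
  exact Finset.sum_congr rfl fun α _ => by ring

lemma dunklReflect_inner_right {d : ℕ} (α x y : E d) :
    ⟪y, dunklReflect α x⟫ = ⟪y, x⟫ - 2 * ⟪α, x⟫ / ‖α‖ ^ 2 * ⟪y, α⟫ := by
  simp [dunklReflect, inner_sub_right, inner_smul_right]

lemma inner_dunklReflect_self {d : ℕ} {α : E d} (hα : α ≠ 0) (x : E d) :
    ⟪α, dunklReflect α x⟫ = -⟪α, x⟫ := by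
  have : ‖α‖ ≠ 0 := norm_ne_zero_iff.2 hα
  rw [dunklReflect_inner_right, real_inner_self_eq_norm_sq]
  field_simp
  ring

lemma dunklReflect_dunklReflect {d : ℕ} {α : E d} (hα : α ≠ 0) (x : E d) :
    dunklReflect α (dunklReflect α x) = x := by
  have h := inner_dunklReflect_self hα x
  rw [dunklReflect, h, dunklReflect, sub_sub, ← add_smul]
  simp [neg_div]

lemma inner_dunklReflect_comm {d : ℕ} (α x y : E d) :
    ⟪dunklReflect α x, y⟫ = ⟪x, dunklReflect α y⟫ := by
  simp [dunklReflect, inner_sub_right, inner_smul_right, inner_sub_left, inner_smul_left,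
    real_inner_comm x α]
  ring

lemma norm_dunklReflect {d : ℕ} {α : E d} (hα : α ≠ 0) (x : E d) :
    ‖dunklReflect α x‖ = ‖x‖ := by
  have h : ⟪dunklReflect α x, dunklReflect α x⟫ = ⟪x, x⟫ := by
    rw [inner_dunklReflect_comm, dunklReflect_dunklReflect hα]
  rw [real_inner_self_eq_norm_sq, real_inner_self_eq_norm_sq] at h
  exact (sq_eq_sq₀ (norm_nonneg _) (norm_nonneg _)).1 h

lemma continuous_dunklReflect {d : ℕ} (α : E d) : Continuous (dunklReflect α) := by
  unfold dunklReflect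
  fun_prop

/-- Affine functions on `E d`. -/
def affineFun (d : ℕ) : Submodule ℝ (E d → ℝ) :=
  LinearMap.range ({ toFun := fun p x => p.1 + ⟪p.2, x⟫
                     map_add' := fun p q => by
                       funext x; simp [inner_add_left]; ring
                     map_smul' := fun c p => by
                       funext x; simp [inner_smul_left]; ring } : (ℝ × E d) →ₗ[ℝ] (E d → ℝ))

lemma mem_affineFun {d : ℕ} {p : E d → ℝ} :
    p ∈ affineFun d ↔ ∃ (c : ℝ) (a : E d), p = fun x => c + ⟪a, x⟫ := by
  constructor
  · rintro ⟨⟨c, a⟩, rfl⟩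
    exact ⟨c, a, rfl⟩
  · rintro ⟨c, a, rfl⟩
    exact ⟨(c, a), rfl⟩

lemma affineFun_fg (d : ℕ) : (affineFun d).FG := by
  unfold affineFun
  rw [LinearMap.range_eq_map]
  exact Submodule.FG.map _ Module.Finite.fg_top

lemma one_le_affineFun (d : ℕ) : (1 : Submodule ℝ (E d → ℝ)) ≤ affineFun d := by
  intro p hp
  obtain ⟨c, rfl⟩ := Submodule.mem_one.1 hp
  exact mem_affineFun.2 ⟨c, 0, by funext x; simp⟩

/-- Polynomial functions on `E d` of degree at most `n`; the zero function only if `n < 0`. -/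
def polyFun (d : ℕ) (n : ℤ) : Submodule ℝ (E d → ℝ) :=
  if n < 0 then ⊥ else affineFun d ^ n.toNat

lemma polyFun_natCast (d n : ℕ) : polyFun d (n : ℤ) = affineFun d ^ n := by
  simp [polyFun]

lemma polyFun_of_neg {d : ℕ} {n : ℤ} (hn : n < 0) : polyFun d n = ⊥ := by
  simp [polyFun, hn]

lemma polyFun_mono {d : ℕ} {m n : ℤ} (h : m ≤ n) : polyFun d m ≤ polyFun d n := by
  rcases lt_or_ge m 0 with hm | hm
  · simp [polyFun_of_neg hm]
  · lift m to ℕ using hm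
    lift n to ℕ using (by omega)
    rw [polyFun_natCast, polyFun_natCast]
    have h1 : (1 : Submodule ℝ (E d → ℝ)) ≤ affineFun d ^ (n - m) :=
      one_le_pow_of_one_le' (one_le_affineFun d) _
    calc affineFun d ^ m = affineFun d ^ m * 1 := (mul_one _).symm
      _ ≤ affineFun d ^ m * affineFun d ^ (n - m) := mul_le_mul_right h1 _
      _ = affineFun d ^ n := by rw [← pow_add]; congr 1; omega

lemma mul_mem_polyFun {d : ℕ} {m n : ℤ} {p q : E d → ℝ} (hp : p ∈ polyFun d m)
    (hq : q ∈ polyFun d n) : (fun x => p x * q x) ∈ polyFun d (m + n) := by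
  rcases lt_or_ge m 0 with hm | hm
  · rw [polyFun_of_neg hm] at hp
    rw [(Submodule.mem_bot ℝ).1 hp]
    convert (polyFun d (m + n)).zero_mem using 1
    funext x; simp
  rcases lt_or_ge n 0 with hn | hn
  · rw [polyFun_of_neg hn] at hq
    rw [(Submodule.mem_bot ℝ).1 hq]
    convert (polyFun d (m + n)).zero_mem using 1
    funext x; simp
  lift m to ℕ using hm
  lift n to ℕ using hn
  rw [← Nat.cast_add, polyFun_natCast, pow_add]
  rw [polyFun_natCast] at hp hq
  exact Submodule.mul_mem_mul hp hq

lemma affine_mem_polyFun {d : ℕ} (c : ℝ) (a : E d) : (fun x => c + ⟪a, x⟫) ∈ polyFun d 1 := by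
  have := polyFun_natCast d 1
  rw [Nat.cast_one, pow_one] at this
  rw [this]
  exact mem_affineFun.2 ⟨c, a, rfl⟩

lemma const_mem_polyFun {d : ℕ} (c : ℝ) : (fun _ : E d => c) ∈ polyFun d 0 := by
  have := polyFun_natCast d 0
  rw [Nat.cast_zero, pow_zero] at this
  rw [this]
  exact Submodule.mem_one.2 ⟨c, by funext x; simp⟩

lemma const_mul_mem_polyFun {d : ℕ} {n : ℤ} {p : E d → ℝ} (c : ℝ) (hp : p ∈ polyFun d n) :
    (fun x => c * p x) ∈ polyFun d n := (polyFun d n).smul_mem c hp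

lemma add_mem_polyFun {d : ℕ} {n : ℤ} {p q : E d → ℝ} (hp : p ∈ polyFun d n)
    (hq : q ∈ polyFun d n) : (fun x => p x + q x) ∈ polyFun d n := (polyFun d n).add_mem hp hq

lemma affine_mul_mem_polyFun {d : ℕ} {n : ℤ} {q : E d → ℝ} (c : ℝ) (a : E d)
    (hq : q ∈ polyFun d n) : (fun x => (c + ⟪a, x⟫) * q x) ∈ polyFun d (n + 1) := by
  have := mul_mem_polyFun (affine_mem_polyFun c a) hq
  rwa [add_comm] at this

lemma polyFun_induction {d : ℕ} {P : ∀ (n : ℤ) (p : E d → ℝ), p ∈ polyFun d n → Prop}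
    (zero : ∀ n < 0, P n 0 (Submodule.zero_mem _))
    (const : ∀ c, P 0 (fun _ => c) (const_mem_polyFun c))
    (add : ∀ n p q hp hq, P n p hp → P n q hq → P n (fun x => p x + q x) (add_mem_polyFun hp hq))
    (mul : ∀ n c a q hq, P n q hq →
      P (n + 1) (fun x => (c + ⟪a, x⟫) * q x) (affine_mul_mem_polyFun c a hq))
    {n : ℤ} {p : E d → ℝ} (hp : p ∈ polyFun d n) : P n p hp := by
  rcases lt_or_ge n 0 with hn | hn
  · have hp' := hp
    rw [polyFun_of_neg hn] at hp'
    obtain rfl := (Submodule.mem_bot ℝ).1 hp'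
    exact zero n hn
  lift n to ℕ using hn
  have hp' := hp
  rw [polyFun_natCast] at hp'
  revert hp
  induction hp' using Submodule.pow_induction_on_left' with
  | algebraMap r => exact fun _ => const r
  | add x y i hx hy h1 h2 =>
    rw [← polyFun_natCast] at hx hy
    exact fun _ => add i x y hx hy (h1 hx) (h2 hy)
  | mem_mul m hm i x hx h =>
    rw [← polyFun_natCast] at hx
    obtain ⟨c, a, rfl⟩ := mem_affineFun.1 hm
    have h3 := mul i c a x hx (h hx)
    rw [Nat.succ_eq_add_one, Nat.cast_add, Nat.cast_one]
    exact fun _ => h3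

lemma contDiff_of_mem_polyFun {d : ℕ} {n : ℤ} {p : E d → ℝ} (hp : p ∈ polyFun d n)
    {m : WithTop ℕ∞} : ContDiff ℝ m p := by
  induction hp using polyFun_induction with
  | zero => exact contDiff_const
  | const c => exact contDiff_const
  | add n p q _ _ h1 h2 => exact h1.add h2
  | mul n c a q _ h => exact (contDiff_const.add (contDiff_const.inner ℝ contDiff_id)).mul h

lemma differentiable_of_mem_polyFun {d : ℕ} {n : ℤ} {p : E d → ℝ} (hp : p ∈ polyFun d n) :
    Differentiable ℝ p :=
  (contDiff_of_mem_polyFun (m := 1) hp).differentiable (by norm_num)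

lemma comp_dunklReflect_mem_polyFun {d : ℕ} (α : E d) {n : ℤ} {p : E d → ℝ}
    (hp : p ∈ polyFun d n) : (fun x => p (dunklReflect α x)) ∈ polyFun d n := by
  induction hp using polyFun_induction with
  | zero => exact Submodule.zero_mem _
  | const c => exact const_mem_polyFun c
  | add n p q _ _ h1 h2 => exact add_mem_polyFun h1 h2
  | mul n c a q _ h =>
    rw [add_comm]
    simp only [← inner_dunklReflect_comm]
    exact mul_mem_polyFun (affine_mem_polyFun c _) h

lemma fderiv_affine_mul {d : ℕ} (c : ℝ) (a : E d) {q : E d → ℝ} (hq : Differentiable ℝ q)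
    (x e : E d) : fderiv ℝ (fun x => (c + ⟪a, x⟫) * q x) x e
      = (c + ⟪a, x⟫) * fderiv ℝ q x e + ⟪a, e⟫ * q x := by
  have h : HasFDerivAt (fun x => c + ⟪a, x⟫) (innerSL ℝ a) x := by
    simpa using (innerSL ℝ a).hasFDerivAt.const_add c
  have h' : HasFDerivAt (fun x => (c + ⟪a, x⟫) * q x) _ x := h.mul (hq x).hasFDerivAt
  rw [h'.fderiv]
  simp
  ring

lemma fderiv_mem_polyFun {d : ℕ} (e : E d) {n : ℤ} {p : E d → ℝ}
    (hp : p ∈ polyFun d n) : (fun x => fderiv ℝ p x e) ∈ polyFun d (n - 1) := by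
  induction hp using polyFun_induction with
  | zero => simp; exact Submodule.zero_mem _
  | const c => simp; exact Submodule.zero_mem _
  | add n p q hp hq h1 h2 =>
    convert add_mem_polyFun h1 h2 using 2 with x
    rw [fderiv_fun_add (differentiable_of_mem_polyFun hp x) (differentiable_of_mem_polyFun hq x)]
    rfl
  | mul n c a q hq h =>
    simp only [fderiv_affine_mul c a (differentiable_of_mem_polyFun hq), add_sub_cancel_right]
    refine add_mem_polyFun ?_ (const_mul_mem_polyFun _ hq)
    have := mul_mem_polyFun (affine_mem_polyFun c a) h
    rwa [add_sub_cancel] at this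

lemma exists_reflection_quotient {d : ℕ} {α : E d} {n : ℤ} {p : E d → ℝ}
    (hp : p ∈ polyFun d n) :
    ∃ s ∈ polyFun d (n - 1), ∀ x, p x - p (dunklReflect α x) = ⟪α, x⟫ * s x := by
  induction hp using polyFun_induction with
  | zero => exact ⟨0, Submodule.zero_mem _, by simp⟩
  | const c => exact ⟨0, Submodule.zero_mem _, by simp⟩
  | add n p q hp hq h1 h2 =>
    obtain ⟨s, hs, h1⟩ := h1
    obtain ⟨t, ht, h2⟩ := h2
    refine ⟨_, add_mem_polyFun hs ht, fun x => ?_⟩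
    linear_combination h1 x + h2 x
  | mul n c a q hq h =>
    obtain ⟨s, hs, h⟩ := h
    refine ⟨fun x => (c + ⟪a, x⟫) * s x + (2 / ‖α‖ ^ 2 * ⟪a, α⟫) * q (dunklReflect α x),
      ?_, fun x => ?_⟩
    · rw [add_sub_cancel_right]
      refine add_mem_polyFun ?_ (const_mul_mem_polyFun _ (comp_dunklReflect_mem_polyFun α hq))
      have := mul_mem_polyFun (affine_mem_polyFun c a) hs
      rwa [add_sub_cancel] at this
    · simp only [dunklReflect_inner_right]
      linear_combination (c + ⟪a, x⟫) * h x

lemma exists_dunklTerm_mem_polyFun {d : ℕ} {α : E d} (hα : α ≠ 0) {n : ℤ} {p : E d → ℝ}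
    (hp : p ∈ polyFun d n) :
    ∃ s ∈ polyFun d (n - 2), ∀ x, ⟪α, x⟫ ≠ 0 → dunklTerm α p x = s x := by
  have hα' : ‖α‖ ≠ 0 := norm_ne_zero_iff.2 hα
  induction hp using polyFun_induction with
  | zero => exact ⟨0, Submodule.zero_mem _, by simp [dunklTerm]⟩
  | const c => exact ⟨0, Submodule.zero_mem _, by simp [dunklTerm]⟩
  | add n p q hp hq h1 h2 =>
    obtain ⟨s, hs, h1⟩ := h1
    obtain ⟨t, ht, h2⟩ := h2
    refine ⟨_, add_mem_polyFun hs ht, fun x hx => ?_⟩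
    rw [dunklTerm_add α (differentiable_of_mem_polyFun hp) (differentiable_of_mem_polyFun hq),
      h1 x hx, h2 x hx]
  | mul n c a q hq h =>
    obtain ⟨s, hs, h⟩ := h
    obtain ⟨t, ht, h'⟩ := exists_reflection_quotient (α := α) hq
    refine ⟨fun x => (c + ⟪a, x⟫) * s x + ⟪a, α⟫ * t x, ?_, fun x hx => ?_⟩
    · rw [show n + 1 - 2 = n - 1 by ring]
      refine add_mem_polyFun ?_ (const_mul_mem_polyFun _ ht)
      have := mul_mem_polyFun (affine_mem_polyFun c a) hs
      rwa [show 1 + (n - 2) = n - 1 by ring] at this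
    · have h1 := h x hx
      have h2 := h' x
      simp only [dunklTerm] at h1 ⊢
      rw [fderiv_affine_mul c a (differentiable_of_mem_polyFun hq), dunklReflect_inner_right,
        ← h1, show t x = (q x - q (dunklReflect α x)) / ⟪α, x⟫ by rw [h2]; field_simp]
      field_simp
      ring

lemma lap_mem_polyFun {d : ℕ} {n : ℤ} {p : E d → ℝ} (hp : p ∈ polyFun d n) :
    lap p ∈ polyFun d (n - 2) := by
  have : lap p = ∑ i : Fin d, fun x => fderiv ℝ (fun y => fderiv ℝ p y
      (EuclideanSpace.single i 1)) x (EuclideanSpace.single i 1) := by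
    funext x
    rw [lap_eq (contDiff_of_mem_polyFun hp), Finset.sum_apply]
  rw [this]
  refine Submodule.sum_mem _ fun i _ => ?_
  have := fderiv_mem_polyFun (EuclideanSpace.single i 1)
    (fderiv_mem_polyFun (EuclideanSpace.single i 1) hp)
  rwa [sub_sub] at this

lemma exists_dunklLap_mem_polyFun {d : ℕ} {R : Finset (E d)} (hR0 : ∀ α ∈ R, α ≠ 0)
    (k : E d → ℝ) {n : ℤ} {p : E d → ℝ} (hp : p ∈ polyFun d n) :
    ∃ P ∈ polyFun d (n - 2), ∀ x ∈ offWalls R, dunklLap R k p x = P x := by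
  choose! s hs h using fun α (hα : α ∈ R) => exists_dunklTerm_mem_polyFun (hR0 α hα) hp
  refine ⟨fun x => lap p x + (∑ α ∈ R, fun y => k α * s α y) x,
    add_mem_polyFun (lap_mem_polyFun hp) (Submodule.sum_mem _ fun α hα =>
      const_mul_mem_polyFun _ (hs α hα)), fun x hx => ?_⟩
  simp only [dunklLap_eq, Finset.sum_apply]
  congr 1
  exact Finset.sum_congr rfl fun α hα => by rw [h α hα x (hx α hα)]

lemma norm_sq_mem_polyFun (d : ℕ) : (fun x : E d => ‖x‖ ^ 2) ∈ polyFun d 2 := by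
  have : (fun x : E d => ‖x‖ ^ 2) = ∑ i : Fin d, fun x : E d =>
      (0 + ⟪EuclideanSpace.single i 1, x⟫) * (0 + ⟪EuclideanSpace.single i 1, x⟫) := by
    funext x
    rw [EuclideanSpace.norm_sq_eq, Finset.sum_apply]
    refine Finset.sum_congr rfl fun i _ => ?_
    simp [sq, EuclideanSpace.inner_single_left]
  rw [this]
  exact Submodule.sum_mem _ fun i _ =>
    mul_mem_polyFun (m := 1) (n := 1) (affine_mem_polyFun _ _) (affine_mem_polyFun _ _)

lemma ae_inner_ne_zero {d : ℕ} {α : E d} (hα : α ≠ 0) : ∀ᵐ x : E d, ⟪α, x⟫ ≠ 0 := by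
  have h : (LinearMap.ker (innerSL ℝ α).toLinearMap : Submodule ℝ (E d)) ≠ ⊤ := by
    intro h
    have h1 : α ∈ LinearMap.ker (innerSL ℝ α).toLinearMap := h ▸ Submodule.mem_top
    have h2 : ⟪α, α⟫ = 0 := by simpa using h1
    exact hα (inner_self_eq_zero.1 h2)
  have h' := Measure.addHaar_submodule (volume : Measure (E d)) _ h
  rw [ae_iff]
  convert h' using 2
  ext x
  simp

lemma ae_offWalls {d : ℕ} {R : Finset (E d)} (hR0 : ∀ α ∈ R, α ≠ 0) :
    ∀ᵐ x : E d, x ∈ offWalls R := by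
  have := (Finset.eventually_all R).2 fun α hα => ae_inner_ne_zero (hR0 α hα)
  exact this

lemma dense_offWalls {d : ℕ} {R : Finset (E d)} (hR0 : ∀ α ∈ R, α ≠ 0) :
    Dense (offWalls R) := Measure.dense_of_ae (ae_offWalls hR0)

lemma eq_of_eqOn_offWalls {d : ℕ} {R : Finset (E d)} (hR0 : ∀ α ∈ R, α ≠ 0) {p q : E d → ℝ}
    (hp : Continuous p) (hq : Continuous q) (h : ∀ x ∈ offWalls R, p x = q x) : p = q :=
  Continuous.ext_on (dense_offWalls hR0) hp hq h

lemma hasDerivAt_comp_line {d : ℕ} {u : E d → ℝ} (hu : Differentiable ℝ u) (x e : E d) (t : ℝ) :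
    HasDerivAt (fun t : ℝ => u (x + t • e)) (fderiv ℝ u (x + t • e) e) t := by
  have h1 : HasDerivAt (fun t : ℝ => x + t • e) e t := by
    simpa using ((hasDerivAt_id t).smul_const e).const_add x
  exact (hu (x + t • e)).hasFDerivAt.comp_hasDerivAt t h1

lemma eventually_line {d : ℕ} {x : E d} {P : E d → Prop} (h : ∀ᶠ y in 𝓝 x, P y) (e : E d) :
    ∀ᶠ t : ℝ in 𝓝 0, P (x + t • e) := by
  have h1 : Tendsto (fun t : ℝ => x + t • e) (𝓝 0) (𝓝 x) := by
    have : Continuous (fun t : ℝ => x + t • e) := by fun_prop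
    simpa using this.tendsto 0
  exact h1.eventually h

lemma lap_nonpos_of_isLocalMax {d : ℕ} {u : E d → ℝ} (hu : ContDiff ℝ 2 u) {x : E d}
    (hx : IsLocalMax u x) : lap u x ≤ 0 := by
  have hd : Differentiable ℝ u := hu.differentiable (by norm_num)
  rw [lap_eq hu]
  refine Finset.sum_nonpos fun i _ => ?_
  set e : E d := EuclideanSpace.single i 1
  by_contra! hpos
  have hg : deriv (fun t : ℝ => u (x + t • e)) = fun t => fderiv ℝ u (x + t • e) e := by
    funext t
    exact (hasDerivAt_comp_line hd x e t).deriv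
  have hgg : deriv (deriv (fun t : ℝ => u (x + t • e))) 0
      = fderiv ℝ (fun y => fderiv ℝ u y e) x e := by
    rw [hg]
    simpa using (hasDerivAt_comp_line (differentiable_fderiv_apply hu e) x e 0).deriv
  have h0 : deriv (fun t : ℝ => u (x + t • e)) 0 = 0 := by
    rw [hg]
    simp [hx.fderiv_eq_zero]
  have hmin := isLocalMin_of_deriv_deriv_pos (hgg ▸ hpos) h0
    (hasDerivAt_comp_line hd x e 0).continuousAt
  have hconst : (fun t : ℝ => u (x + t • e)) =ᶠ[𝓝 0] fun _ => u x := by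
    filter_upwards [hmin, eventually_line hx e] with t h1 h2
    simp only [zero_smul, add_zero] at h1
    exact le_antisymm h2 h1
  have : deriv (deriv (fun t : ℝ => u (x + t • e))) 0 = 0 := by
    rw [hconst.deriv.deriv_eq]
    simp
  linarith

lemma dunklReflect_add_smul {d : ℕ} {α x : E d} (hα : α ≠ 0) (hx : ⟪α, x⟫ = 0) (t : ℝ) :
    dunklReflect α (x + t • α) = x + (-t) • α := by
  have : ‖α‖ ≠ 0 := norm_ne_zero_iff.2 hα
  rw [dunklReflect, inner_add_right, hx, inner_smul_right, real_inner_self_eq_norm_sq, zero_add,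
    show 2 * (t * ‖α‖ ^ 2) / ‖α‖ ^ 2 = 2 * t by field_simp]
  module

lemma dunklTerm_wall_nonpos {d : ℕ} {α : E d} (hα : α ≠ 0) {u s : E d → ℝ}
    (hu : Differentiable ℝ u) (hs : Continuous s)
    (h : ∀ x, ⟪α, x⟫ ≠ 0 → dunklTerm α u x = s x) {x : E d} (hx : ⟪α, x⟫ = 0)
    (hmax : IsLocalMax u x) : s x ≤ 0 := by
  have hα' : 0 < ‖α‖ := norm_pos_iff.2 hα
  by_contra! hpos
  have h1 := eventually_line (hs.continuousAt.eventually (lt_mem_nhds hpos)) α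
  have h2 := eventually_line hmax α
  obtain ⟨δ, hδ, hb⟩ := Metric.eventually_nhds_iff.1 (h1.and h2)
  simp only [dist_zero_right, Real.norm_eq_abs] at hb
  have hde : ∀ t, HasDerivAt (fun t : ℝ => u (x + t • α) + u (x + (-t) • α))
      (fderiv ℝ u (x + t • α) α - fderiv ℝ u (x + (-t) • α) α) t := by
    intro t
    have := (hasDerivAt_comp_line hu x α t).add
      ((hasDerivAt_comp_line hu x α (-t)).comp t (hasDerivAt_neg t))
    rw [mul_neg_one, ← sub_eq_add_neg] at this
    exact this
  have hmono : StrictMonoOn (fun t : ℝ => u (x + t • α) + u (x + (-t) • α))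
      (Set.Icc 0 (δ / 2)) := by
    refine strictMonoOn_of_deriv_pos (convex_Icc _ _)
      (fun t _ => (hde t).continuousAt.continuousWithinAt) fun t ht => ?_
    rw [interior_Icc] at ht
    rw [(hde t).deriv]
    have hin : ∀ t : ℝ, ⟪α, x + t • α⟫ = t * ‖α‖ ^ 2 := fun t => by
      rw [inner_add_right, hx, inner_smul_right, real_inner_self_eq_norm_sq, zero_add]
    have ht0 := ht.1
    have e1 := h (x + t • α) (by rw [hin]; positivity)
    have e2 := h (x + (-t) • α) (by rw [hin]; exact mul_ne_zero (neg_ne_zero.2 ht0.ne') (by positivity))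
    have p1 := (hb (y := t) (by rw [abs_of_pos ht.1]; linarith [ht.2])).1
    have p2 := (hb (y := -t) (by rw [abs_neg, abs_of_pos ht.1]; linarith [ht.2])).1
    rw [dunklTerm, hin, dunklReflect_add_smul hα hx] at e1 e2
    rw [neg_neg] at e2
    have e3 : (fderiv ℝ u (x + t • α) α - fderiv ℝ u (x + (-t) • α) α) =
        (t * ‖α‖ ^ 2) * (s (x + t • α) + s (x + (-t) • α)) := by
      rw [← e1, ← e2]
      field_simp
      ring
    rw [e3]
    positivity
  have h3 := hmono (Set.left_mem_Icc.2 (by linarith)) (Set.right_mem_Icc.2 (by linarith))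
    (by linarith : (0 : ℝ) < δ / 2)
  have p1 := (hb (y := δ / 2) (by rw [abs_of_pos (by linarith)]; linarith)).2
  have p2 := (hb (y := -(δ / 2)) (by rw [abs_neg, abs_of_pos (by linarith)]; linarith)).2
  simp only [zero_smul, add_zero, neg_zero] at h3
  linarith

lemma dunklLap_nonpos_of_isMax {d : ℕ} {R : Finset (E d)} (hR0 : ∀ α ∈ R, α ≠ 0) {k : E d → ℝ}
    (hkpos : ∀ α ∈ R, 0 < k α) {n : ℤ} {p P : E d → ℝ} (hp : p ∈ polyFun d n)
    (hP : Continuous P) (h : ∀ x ∈ offWalls R, dunklLap R k p x = P x) {x : E d}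
    (hmax : IsLocalMax p x) (hrefl : ∀ α ∈ R, p (dunklReflect α x) ≤ p x) : P x ≤ 0 := by
  choose! s hs hsp using fun α (hα : α ∈ R) => exists_dunklTerm_mem_polyFun (hR0 α hα) hp
  have hsc : ∀ α ∈ R, Continuous (s α) := fun α hα =>
    (contDiff_of_mem_polyFun (m := 0) (hs α hα)).continuous
  have e : P = fun x => lap p x + ∑ α ∈ R, k α * s α x := by
    refine eq_of_eqOn_offWalls hR0 hP ?_ fun x hx => ?_
    · exact (contDiff_of_mem_polyFun (m := 0) (lap_mem_polyFun hp)).continuous.add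
        (continuous_finsetSum _ fun α hα => continuous_const.mul (hsc α hα))
    · rw [← h x hx, dunklLap_eq]
      congr 1
      exact Finset.sum_congr rfl fun α hα => by rw [hsp α hα x (hx α hα)]
  have h1 := lap_nonpos_of_isLocalMax (contDiff_of_mem_polyFun hp) hmax
  have h2 : ∑ α ∈ R, k α * s α x ≤ 0 := by
    refine Finset.sum_nonpos fun α hα => mul_nonpos_of_nonneg_of_nonpos (hkpos α hα).le ?_
    by_cases hx : ⟪α, x⟫ = 0
    · exact dunklTerm_wall_nonpos (hR0 α hα) (differentiable_of_mem_polyFun hp) (hsc α hα)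
        (hsp α hα) hx hmax
    · rw [← hsp α hα x hx, dunklTerm, hmax.fderiv_eq_zero]
      have := hrefl α hα
      have h3 : 0 ≤ ‖α‖ ^ 2 / 2 * ((p x - p (dunklReflect α x)) / ⟪α, x⟫ ^ 2) := by
        have : 0 ≤ p x - p (dunklReflect α x) := by linarith
        positivity
      simpa using h3
  rw [e]
  linarith

lemma fderiv_radial_mul {d : ℕ} {F : ℝ → ℝ} (hF : Differentiable ℝ F) {q : E d → ℝ}
    (hq : Differentiable ℝ q) (x e : E d) :
    fderiv ℝ (fun y => F (‖y‖ ^ 2) * q y) x e =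
      deriv F (‖x‖ ^ 2) * (2 * ⟪x, e⟫ * q x) + F (‖x‖ ^ 2) * fderiv ℝ q x e := by
  have h1 : HasFDerivAt (fun y : E d => F (‖y‖ ^ 2)) _ x :=
    (hF (‖x‖ ^ 2)).hasDerivAt.comp_hasFDerivAt x (hasStrictFDerivAt_norm_sq x).hasFDerivAt
  have h2 : HasFDerivAt (fun y => F (‖y‖ ^ 2) * q y) _ x := h1.mul (hq x).hasFDerivAt
  rw [h2.fderiv]
  simp
  ring

lemma fderiv_two_inner_mul {d : ℕ} {q : E d → ℝ} (hq : Differentiable ℝ q) (x e : E d) :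
    fderiv ℝ (fun y => 2 * ⟪y, e⟫ * q y) x e =
      2 * ⟪e, e⟫ * q x + 2 * ⟪x, e⟫ * fderiv ℝ q x e := by
  have h := fderiv_affine_mul 0 ((2 : ℝ) • e) hq x e
  simp only [zero_add, inner_smul_left, conj_trivial] at h
  simp only [real_inner_comm e] at h ⊢
  rw [h]
  ring

lemma sum_inner_mul_fderiv {d : ℕ} (q : E d → ℝ) (x v : E d) :
    ∑ i : Fin d, ⟪v, EuclideanSpace.single i 1⟫ * fderiv ℝ q x (EuclideanSpace.single i 1)
      = fderiv ℝ q x v := by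
  conv_rhs => rw [← (EuclideanSpace.basisFun (Fin d) ℝ).sum_repr v]
  rw [map_sum]
  refine Finset.sum_congr rfl fun i _ => ?_
  simp [EuclideanSpace.inner_single_right]

lemma lap_radial_mul {d : ℕ} {F : ℝ → ℝ} (hF : ContDiff ℝ 2 F) {q : E d → ℝ}
    (hq : ContDiff ℝ 2 q) (x : E d) :
    lap (fun y => F (‖y‖ ^ 2) * q y) x = F (‖x‖ ^ 2) * lap q x
      + 4 * deriv F (‖x‖ ^ 2) * fderiv ℝ q x x
      + q x * (4 * ‖x‖ ^ 2 * deriv (deriv F) (‖x‖ ^ 2) + 2 * d * deriv F (‖x‖ ^ 2)) := by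
  have hF1 : Differentiable ℝ F := hF.differentiable (by norm_num)
  have hF2 : Differentiable ℝ (deriv F) :=
    ((contDiff_succ_iff_deriv (n := 1)).1 hF).2.2.differentiable (by norm_num)
  have hq1 : Differentiable ℝ q := hq.differentiable (by norm_num)
  have hn : ContDiff ℝ 2 (fun y : E d => F (‖y‖ ^ 2) * q y) :=
    (hF.comp (contDiff_norm_sq ℝ)).mul hq
  have hterm : ∀ e : E d, fderiv ℝ (fun y => fderiv ℝ (fun y => F (‖y‖ ^ 2) * q y) y e) x e =
      4 * deriv (deriv F) (‖x‖ ^ 2) * q x * ⟪x, e⟫ ^ 2 + 2 * deriv F (‖x‖ ^ 2) * q x * ⟪e, e⟫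
      + 4 * deriv F (‖x‖ ^ 2) * (⟪x, e⟫ * fderiv ℝ q x e)
      + F (‖x‖ ^ 2) * fderiv ℝ (fun y => fderiv ℝ q y e) x e := by
    intro e
    have hqe := differentiable_fderiv_apply hq e
    have hm : Differentiable ℝ (fun y : E d => 2 * ⟪y, e⟫ * q y) :=
      ((differentiable_id.inner ℝ (differentiable_const e)).const_mul 2).mul hq1
    have hnd : Differentiable ℝ (fun y : E d => ‖y‖ ^ 2) :=
      (contDiff_norm_sq ℝ (n := 1)).differentiable (by norm_num)
    have e1 : (fun y => fderiv ℝ (fun y => F (‖y‖ ^ 2) * q y) y e) = fun y =>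
        deriv F (‖y‖ ^ 2) * (2 * ⟪y, e⟫ * q y) + F (‖y‖ ^ 2) * fderiv ℝ q y e := by
      funext y
      exact fderiv_radial_mul hF1 hq1 y e
    have hA : DifferentiableAt ℝ (fun y : E d => deriv F (‖y‖ ^ 2) * (2 * ⟪y, e⟫ * q y)) x :=
      ((hF2.comp hnd).mul hm) x
    have hB : DifferentiableAt ℝ (fun y : E d => F (‖y‖ ^ 2) * fderiv ℝ q y e) x :=
      ((hF1.comp hnd).mul hqe) x
    rw [e1, fderiv_fun_add hA hB]
    rw [add_apply, fderiv_radial_mul hF2 hm, fderiv_radial_mul hF1 hqe,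
      fderiv_two_inner_mul hq1]
    ring
  have h1 : ∑ i : Fin d, ⟪x, EuclideanSpace.single i 1⟫ ^ 2 = ‖x‖ ^ 2 := by
    rw [EuclideanSpace.norm_sq_eq]
    simp [EuclideanSpace.inner_single_right]
  have h2 : ∑ i : Fin d, ⟪(EuclideanSpace.single i 1 : E d), EuclideanSpace.single i 1⟫
      = (d : ℝ) := by
    simp
  rw [lap_eq hn, lap_eq hq]
  simp only [hterm, Finset.sum_add_distrib, ← Finset.mul_sum, sum_inner_mul_fderiv, h1, h2]
  ring

lemma dunklLap_radial_mul {d : ℕ} {R : Finset (E d)} (hR0 : ∀ α ∈ R, α ≠ 0) (k : E d → ℝ)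
    {F : ℝ → ℝ} (hF : ContDiff ℝ 2 F) {q : E d → ℝ}
    (hq : ContDiff ℝ 2 q) {x : E d} (hx : x ∈ offWalls R) :
    dunklLap R k (fun y => F (‖y‖ ^ 2) * q y) x = F (‖x‖ ^ 2) * dunklLap R k q x
      + 4 * deriv F (‖x‖ ^ 2) * fderiv ℝ q x x
      + q x * (4 * ‖x‖ ^ 2 * deriv (deriv F) (‖x‖ ^ 2)
        + 2 * (d + ∑ α ∈ R, k α) * deriv F (‖x‖ ^ 2)) := by
  have hF1 : Differentiable ℝ F := hF.differentiable (by norm_num)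
  have hq1 : Differentiable ℝ q := hq.differentiable (by norm_num)
  have h1 : ∀ α ∈ R, k α * dunklTerm α (fun y => F (‖y‖ ^ 2) * q y) x =
      F (‖x‖ ^ 2) * (k α * dunklTerm α q x) + (2 * deriv F (‖x‖ ^ 2) * q x) * k α := by
    intro α hα
    have hxα := hx α hα
    rw [dunklTerm, fderiv_radial_mul hF1 hq1, norm_dunklReflect (hR0 α hα), dunklTerm,
      real_inner_comm α x]
    have hxα' : ⟪x, α⟫ ≠ 0 := by rwa [real_inner_comm]
    field_simp
    ring
  rw [dunklLap_eq, dunklLap_eq, lap_radial_mul hF hq, Finset.sum_congr rfl h1,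
    Finset.sum_add_distrib, ← Finset.mul_sum, ← Finset.mul_sum]
  ring

/-- `P` is the Dunkl Laplacian of the polynomial function `p`. -/
def IsPolyPair {d : ℕ} (R : Finset (E d)) (k : E d → ℝ) (p P : E d → ℝ) : Prop :=
  (∃ n : ℤ, p ∈ polyFun d n) ∧ (∃ n : ℤ, P ∈ polyFun d n) ∧
    ∀ x ∈ offWalls R, dunklLap R k p x = P x

lemma IsPolyPair.continuous_left {d : ℕ} {R : Finset (E d)} {k : E d → ℝ} {p P : E d → ℝ}
    (h : IsPolyPair R k p P) : Continuous p := by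
  obtain ⟨⟨n, hn⟩, _⟩ := h
  exact (contDiff_of_mem_polyFun (m := 0) hn).continuous

lemma IsPolyPair.continuous_right {d : ℕ} {R : Finset (E d)} {k : E d → ℝ} {p P : E d → ℝ}
    (h : IsPolyPair R k p P) : Continuous P := by
  obtain ⟨_, ⟨n, hn⟩, _⟩ := h
  exact (contDiff_of_mem_polyFun (m := 0) hn).continuous

lemma exists_mem_polyFun_add {d : ℕ} {p q : E d → ℝ} (hp : ∃ n : ℤ, p ∈ polyFun d n)
    (hq : ∃ n : ℤ, q ∈ polyFun d n) : ∃ n : ℤ, (fun x => p x + q x) ∈ polyFun d n := by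
  obtain ⟨m, hm⟩ := hp
  obtain ⟨n, hn⟩ := hq
  exact ⟨max m n, add_mem_polyFun (polyFun_mono (le_max_left _ _) hm)
    (polyFun_mono (le_max_right _ _) hn)⟩

lemma IsPolyPair.add {d : ℕ} {R : Finset (E d)} {k : E d → ℝ} {p P q Q : E d → ℝ}
    (h : IsPolyPair R k p P) (h' : IsPolyPair R k q Q) :
    IsPolyPair R k (fun x => p x + q x) (fun x => P x + Q x) := by
  refine ⟨exists_mem_polyFun_add h.1 h'.1, exists_mem_polyFun_add h.2.1 h'.2.1, fun x hx => ?_⟩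
  obtain ⟨m, hm⟩ := h.1
  obtain ⟨n, hn⟩ := h'.1
  rw [dunklLap_add R k (contDiff_of_mem_polyFun hm) (contDiff_of_mem_polyFun hn),
    h.2.2 x hx, h'.2.2 x hx]

lemma IsPolyPair.const_mul {d : ℕ} {R : Finset (E d)} {k : E d → ℝ} {p P : E d → ℝ}
    (h : IsPolyPair R k p P) (c : ℝ) :
    IsPolyPair R k (fun x => c * p x) (fun x => c * P x) := by
  obtain ⟨⟨m, hm⟩, ⟨n, hn⟩, h⟩ := h
  refine ⟨⟨m, const_mul_mem_polyFun c hm⟩, ⟨n, const_mul_mem_polyFun c hn⟩, fun x hx => ?_⟩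
  rw [dunklLap_const_mul R k c (contDiff_of_mem_polyFun hm), h x hx]

lemma isPolyPair_const {d : ℕ} (R : Finset (E d)) (k : E d → ℝ) (c : ℝ) :
    IsPolyPair R k (fun _ => c) (fun _ => 0) := by
  refine ⟨⟨0, const_mem_polyFun c⟩, ⟨0, const_mem_polyFun 0⟩, fun x _ => ?_⟩
  rw [dunklLap_eq, lap_eq contDiff_const]
  simp [dunklTerm]

lemma isPolyPair_norm_sq {d : ℕ} {R : Finset (E d)} (hR0 : ∀ α ∈ R, α ≠ 0) (k : E d → ℝ) :
    IsPolyPair R k (fun x => ‖x‖ ^ 2) (fun _ => 2 * (d + ∑ α ∈ R, k α)) := by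
  refine ⟨⟨2, norm_sq_mem_polyFun d⟩, ⟨0, const_mem_polyFun _⟩, fun x hx => ?_⟩
  have h := dunklLap_radial_mul hR0 k (F := fun t => t) contDiff_id (q := fun _ => 1)
    contDiff_const hx
  have h1 := (isPolyPair_const R k 1).2.2 x hx
  have h2 : deriv (fun t : ℝ => t) = fun _ => 1 := by funext t; simp
  simp only [mul_one, h1, h2] at h
  simpa using h

/-- `v` solves `Δ_k v = g` on the closed ball of radius `r` as a uniform limit of polynomials. -/
def StrongPair {d : ℕ} (R : Finset (E d)) (k : E d → ℝ) (r : ℝ) (v g : E d → ℝ) : Prop :=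
  ∀ ε > 0, ∃ p P, IsPolyPair R k p P ∧
    ∀ x ∈ Metric.closedBall (0 : E d) r, |v x - p x| ≤ ε ∧ |g x - P x| ≤ ε

lemma IsPolyPair.strongPair {d : ℕ} {R : Finset (E d)} {k : E d → ℝ} {p P : E d → ℝ}
    (h : IsPolyPair R k p P) (r : ℝ) : StrongPair R k r p P :=
  fun ε hε => ⟨p, P, h, fun x _ => by simp [hε.le]⟩

lemma StrongPair.congr {d : ℕ} {R : Finset (E d)} {k : E d → ℝ} {r : ℝ} {v g v' g' : E d → ℝ}
    (h : StrongPair R k r v g) (hv : ∀ x ∈ Metric.closedBall (0 : E d) r, v x = v' x)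
    (hg : ∀ x ∈ Metric.closedBall (0 : E d) r, g x = g' x) : StrongPair R k r v' g' := by
  intro ε hε
  obtain ⟨p, P, hp, h⟩ := h ε hε
  refine ⟨p, P, hp, fun x hx => ?_⟩
  rw [← hv x hx, ← hg x hx]
  exact h x hx

lemma StrongPair.add {d : ℕ} {R : Finset (E d)} {k : E d → ℝ} {r : ℝ} {v g v' g' : E d → ℝ}
    (h : StrongPair R k r v g) (h' : StrongPair R k r v' g') :
    StrongPair R k r (fun x => v x + v' x) (fun x => g x + g' x) := by
  intro ε hε
  obtain ⟨p, P, hp, h⟩ := h (ε / 2) (by linarith)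
  obtain ⟨q, Q, hq, h'⟩ := h' (ε / 2) (by linarith)
  refine ⟨_, _, hp.add hq, fun x hx => ?_⟩
  obtain ⟨h1, h2⟩ := h x hx
  obtain ⟨h3, h4⟩ := h' x hx
  simp only [abs_le] at *
  constructor <;> constructor <;> linarith

lemma StrongPair.const_mul {d : ℕ} {R : Finset (E d)} {k : E d → ℝ} {r : ℝ} {v g : E d → ℝ}
    (h : StrongPair R k r v g) (c : ℝ) :
    StrongPair R k r (fun x => c * v x) (fun x => c * g x) := by
  intro ε hε
  have hc : 0 < |c| + 1 := by positivity
  obtain ⟨p, P, hp, h⟩ := h (ε / (|c| + 1)) (by positivity)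
  refine ⟨_, _, hp.const_mul c, fun x hx => ?_⟩
  obtain ⟨h1, h2⟩ := h x hx
  rw [le_div_iff₀ hc] at h1 h2
  rw [← mul_sub, ← mul_sub, abs_mul, abs_mul]
  constructor <;> nlinarith [abs_nonneg (v x - p x), abs_nonneg (g x - P x)]

lemma StrongPair.sub {d : ℕ} {R : Finset (E d)} {k : E d → ℝ} {r : ℝ} {v g v' g' : E d → ℝ}
    (h : StrongPair R k r v g) (h' : StrongPair R k r v' g') :
    StrongPair R k r (fun x => v x - v' x) (fun x => g x - g' x) := by
  convert h.add (h'.const_mul (-1)) using 2 <;> ring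

lemma StrongPair.max_principle {d : ℕ} {R : Finset (E d)} (hR0 : ∀ α ∈ R, α ≠ 0) {k : E d → ℝ}
    (hkpos : ∀ α ∈ R, 0 < k α) (hm : 2 < (d : ℝ) + ∑ α ∈ R, k α) {r : ℝ} (hr : 0 < r)
    {v g : E d → ℝ} (h : StrongPair R k r v g) (hv : ∀ x ∈ Metric.sphere (0 : E d) r, v x ≤ 0)
    (hg : ∀ x ∈ Metric.ball (0 : E d) r, 0 < v x → 0 ≤ g x) :
    ∀ x ∈ Metric.closedBall (0 : E d) r, v x ≤ 0 := by
  by_contra! hcon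
  obtain ⟨z, hz, hvz⟩ := hcon
  set m : ℝ := (d : ℝ) + ∑ α ∈ R, k α with hmdef
  set δ : ℝ := v z / (4 * r ^ 2) with hδ
  have hδ0 : 0 < δ := by positivity
  obtain ⟨p, P, hp, hpP⟩ := h (min (v z / 8) (m * δ)) (by positivity)
  have hq := hp.add ((isPolyPair_norm_sq hR0 k).const_mul δ)
  obtain ⟨x, hxK, hx⟩ := (isCompact_closedBall (0 : E d) r).exists_isMaxOn ⟨z, hz⟩
    hq.continuous_left.continuousOn
  have hxz : p z + δ * ‖z‖ ^ 2 ≤ p x + δ * ‖x‖ ^ 2 := hx hz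
  have hε1 := min_le_left (v z / 8) (m * δ)
  have hε2 := min_le_right (v z / 8) (m * δ)
  have h1 := abs_le.1 (hpP z hz).1
  have h2 := abs_le.1 (hpP x hxK).1
  have h3 := abs_le.1 (hpP x hxK).2
  have hxr : ‖x‖ ≤ r := by simpa using hxK
  have hδr : δ * ‖x‖ ^ 2 ≤ v z / 4 := by
    have : δ * r ^ 2 = v z / 4 := by rw [hδ]; field_simp
    rw [← this]
    gcongr
  have hz2 : 0 ≤ δ * ‖z‖ ^ 2 := by positivity
  have hvx : 0 < v x := by linarith
  have hxb : x ∈ Metric.ball (0 : E d) r := by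
    rcases lt_or_eq_of_le hxr with h' | h'
    · simpa using h'
    · exact absurd (hv x (by simpa using h')) (not_le.2 hvx)
  have hmax : IsLocalMax (fun x => p x + δ * ‖x‖ ^ 2) x :=
    hx.isLocalMax (mem_of_superset (Metric.isOpen_ball.mem_nhds hxb) Metric.ball_subset_closedBall)
  obtain ⟨n, hn⟩ := hq.1
  have hfin := dunklLap_nonpos_of_isMax hR0 hkpos hn hq.continuous_right hq.2.2 hmax
    (fun α hα => hx (by simpa [norm_dunklReflect (hR0 α hα)] using hxr))
  have hgx := hg x hxb hvx
  have : 0 < m * δ := by positivity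
  simp only [← hmdef] at hfin
  nlinarith

lemma StrongPair.le {d : ℕ} {R : Finset (E d)} (hR0 : ∀ α ∈ R, α ≠ 0) {k : E d → ℝ}
    (hkpos : ∀ α ∈ R, 0 < k α) (hm : 2 < (d : ℝ) + ∑ α ∈ R, k α) {r : ℝ} (hr : 0 < r)
    {v g : E d → ℝ} (h : StrongPair R k r v g) {a c : ℝ} (ha : 0 ≤ a) (hc : 0 ≤ c)
    (hv : ∀ x ∈ Metric.sphere (0 : E d) r, v x ≤ a)
    (hg : ∀ x ∈ Metric.ball (0 : E d) r, 0 < v x → -c ≤ g x) :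
    ∀ x ∈ Metric.closedBall (0 : E d) r, v x ≤ a + c * r ^ 2 := by
  intro x hx
  set m : ℝ := (d : ℝ) + ∑ α ∈ R, k α with hmdef
  have hm0 : 0 < m := by linarith
  have h' := (h.add (((isPolyPair_const R k (-a - c / (2 * m) * r ^ 2)).add
    ((isPolyPair_norm_sq hR0 k).const_mul (c / (2 * m)))).strongPair r)).max_principle
    hR0 hkpos hm hr ?_ ?_ x hx
  · have h1 : c / (2 * m) * r ^ 2 ≤ c * r ^ 2 := by
      gcongr
      exact div_le_self hc (by linarith)
    have h2 : 0 ≤ c / (2 * m) * ‖x‖ ^ 2 := by positivity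
    linarith
  · intro y hy
    have := hv y hy
    have hy' : ‖y‖ = r := by simpa using hy
    rw [hy']
    linarith
  · intro y hy hvy
    have hy' : ‖y‖ < r := by simpa using hy
    have h1 : c / (2 * m) * ‖y‖ ^ 2 ≤ c / (2 * m) * r ^ 2 := by gcongr
    have := hg y hy (by linarith)
    rw [← hmdef]
    have h3 : c / (2 * m) * (2 * m) = c := by field_simp
    linarith

lemma StrongPair.abs_le {d : ℕ} {R : Finset (E d)} (hR0 : ∀ α ∈ R, α ≠ 0) {k : E d → ℝ}
    (hkpos : ∀ α ∈ R, 0 < k α) (hm : 2 < (d : ℝ) + ∑ α ∈ R, k α) {r : ℝ} (hr : 0 < r)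
    {v g : E d → ℝ} (h : StrongPair R k r v g) {a c : ℝ} (ha : 0 ≤ a) (hc : 0 ≤ c)
    (hv : ∀ x ∈ Metric.sphere (0 : E d) r, |v x| ≤ a)
    (hg : ∀ x ∈ Metric.ball (0 : E d) r, |g x| ≤ c) :
    ∀ x ∈ Metric.closedBall (0 : E d) r, |v x| ≤ a + c * r ^ 2 := by
  intro x hx
  have h1 := h.le hR0 hkpos hm hr ha hc (fun y hy => (_root_.abs_le.1 (hv y hy)).2)
    (fun y hy _ => (_root_.abs_le.1 (hg y hy)).1) x hx
  have h2 := (h.const_mul (-1)).le hR0 hkpos hm hr ha hc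
    (fun y hy => by linarith [(_root_.abs_le.1 (hv y hy)).1])
    (fun y hy _ => by linarith [(_root_.abs_le.1 (hg y hy)).2]) x hx
  exact _root_.abs_le.2 ⟨by linarith, h1⟩

lemma exists_poisson_poly {d : ℕ} {R : Finset (E d)} (hR0 : ∀ α ∈ R, α ≠ 0) {k : E d → ℝ}
    (hkpos : ∀ α ∈ R, 0 < k α) (hm : 2 < (d : ℝ) + ∑ α ∈ R, k α) {r : ℝ} (hr : 0 < r)
    {n : ℕ} {g : E d → ℝ} (hg : g ∈ polyFun d n) :
    ∃ q ∈ polyFun d n, IsPolyPair R k (fun x => (r ^ 2 - ‖x‖ ^ 2) * q x) g := by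
  have hρ : ∀ q ∈ polyFun d n, (fun x => (r ^ 2 - ‖x‖ ^ 2) * q x) ∈ polyFun d (n + 2) := by
    intro q hq
    have h1 : (fun x : E d => r ^ 2 + (-1) * ‖x‖ ^ 2) ∈ polyFun d 2 :=
      add_mem_polyFun (polyFun_mono (by norm_num) (const_mem_polyFun _))
        (const_mul_mem_polyFun _ (norm_sq_mem_polyFun d))
    have := mul_mem_polyFun h1 hq
    rw [add_comm] at this
    convert this using 3
    ring
  let V := polyFun d n
  have hfin : FiniteDimensional ℝ V := by
    change FiniteDimensional ℝ (polyFun d n)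
    rw [polyFun_natCast]
    exact Module.Finite.iff_fg.2 ((affineFun_fg d).pow n)
  let S : Submodule ℝ (V × V) :=
    { carrier := {z | ∀ x ∈ offWalls R,
        dunklLap R k (fun x => (r ^ 2 - ‖x‖ ^ 2) * (z.1 : E d → ℝ) x) x = (z.2 : E d → ℝ) x}
      add_mem' := by
        intro a b ha hb x hx
        have := dunklLap_add R k (contDiff_of_mem_polyFun (hρ _ a.1.2))
          (contDiff_of_mem_polyFun (hρ _ b.1.2)) x
        rw [ha x hx, hb x hx] at this
        simpa [mul_add] using this
      zero_mem' := by
        intro x hx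
        simpa using (isPolyPair_const R k 0).2.2 x hx
      smul_mem' := by
        intro c a ha x hx
        have := dunklLap_const_mul R k c (contDiff_of_mem_polyFun (hρ _ a.1.2)) x
        rw [ha x hx] at this
        simpa [mul_left_comm] using this }
  have h1 : Function.Surjective ((LinearMap.fst ℝ V V).comp S.subtype) := by
    rintro ⟨q, hq⟩
    obtain ⟨P, hP, h⟩ := exists_dunklLap_mem_polyFun hR0 k (hρ q hq)
    rw [add_sub_cancel_right] at hP
    exact ⟨⟨(⟨q, hq⟩, ⟨P, hP⟩), h⟩, rfl⟩
  have h2 : Function.Injective ((LinearMap.snd ℝ V V).comp S.subtype) := by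
    rw [injective_iff_map_eq_zero]
    rintro ⟨⟨⟨q, hq⟩, ⟨P, hP⟩⟩, h⟩ h0
    have hP0 : P = 0 := congrArg Subtype.val h0
    have hpair : IsPolyPair R k (fun x => (r ^ 2 - ‖x‖ ^ 2) * q x) (fun _ => 0) :=
      ⟨⟨_, hρ q hq⟩, ⟨0, const_mem_polyFun 0⟩, fun x hx => by
        rw [h x hx]; exact congrFun hP0 x⟩
    have habs := (hpair.strongPair r).abs_le hR0 hkpos hm hr le_rfl le_rfl
      (fun x hx => by
        have : ‖x‖ = r := by simpa using hx
        simp [this]) (fun x _ => by simp)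
    have hqz : q = 0 := by
      have hqc : Continuous q := (contDiff_of_mem_polyFun (m := 0) hq).continuous
      have hzero : Set.EqOn q 0 (Metric.ball (0 : E d) r) := by
        intro x hx
        have hx' : ‖x‖ < r := by simpa using hx
        have h3 := habs x (Metric.ball_subset_closedBall hx)
        have h4 : (r ^ 2 - ‖x‖ ^ 2) * q x = 0 := by
          apply abs_eq_zero.1
          exact le_antisymm (by simpa using h3) (abs_nonneg _)
        have h5 : r ^ 2 - ‖x‖ ^ 2 ≠ 0 := by
          have : ‖x‖ ^ 2 < r ^ 2 := by gcongr
          linarith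
        exact (mul_eq_zero.1 h4).resolve_left h5
      have han : AnalyticOnNhd ℝ q Set.univ := by
        have : ContDiff ℝ (⊤ : WithTop ℕ∞) q := contDiff_of_mem_polyFun hq
        exact fun x _ => this.contDiffAt.analyticAt
      exact han.eq_of_eventuallyEq (g := 0) (fun x _ => analyticAt_const)
        (hzero.eventuallyEq_of_mem (Metric.ball_mem_nhds 0 hr))
    subst hqz
    subst hP0
    rfl
  have hd1 : Module.finrank ℝ V ≤ Module.finrank ℝ S := LinearMap.finrank_le_finrank_of_surjective h1
  have hd2 : Module.finrank ℝ S ≤ Module.finrank ℝ V := LinearMap.finrank_le_finrank_of_injective h2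
  have hfinS : FiniteDimensional ℝ S := Module.Finite.of_injective _ h2
  have h3 : Function.Surjective ((LinearMap.snd ℝ V V).comp S.subtype) :=
    (LinearMap.injective_iff_surjective_of_finrank_eq_finrank (K := ℝ) (V := S) (V₂ := V)
      (le_antisymm hd2 hd1) (f := (LinearMap.snd ℝ V V).comp S.subtype)).1 h2
  obtain ⟨⟨⟨⟨q, hq⟩, P⟩, h⟩, hs⟩ := h3 ⟨g, hg⟩
  have hPg : P = ⟨g, hg⟩ := hs
  subst hPg
  exact ⟨q, hq, ⟨_, hρ q hq⟩, ⟨_, hg⟩, h⟩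

lemma exists_poly_approx {d : ℕ} (r : ℝ) {f : E d → ℝ} (hf : Continuous f) {ε : ℝ} (hε : 0 < ε) :
    ∃ (n : ℕ) (p : E d → ℝ), p ∈ polyFun d n ∧
      ∀ x ∈ Metric.closedBall (0 : E d) r, |f x - p x| ≤ ε := by
  let c : Fin d → C(Metric.closedBall (0 : E d) r, ℝ) := fun i => ⟨fun x => x.1 i, by fun_prop⟩
  let A := Algebra.adjoin ℝ (Set.range c)
  have hA : A.SeparatesPoints := by
    intro x y hxy
    have : ∃ i, x.1 i ≠ y.1 i := by
      by_contra! h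
      exact hxy (Subtype.ext (by ext i; exact h i))
    obtain ⟨i, hi⟩ := this
    exact ⟨_, ⟨c i, Algebra.subset_adjoin ⟨i, rfl⟩, rfl⟩, hi⟩
  have hrep : ∀ a ∈ A, ∃ (n : ℕ) (p : E d → ℝ), p ∈ polyFun d n ∧ ∀ x, a x = p x.1 := by
    intro a ha
    induction ha using Algebra.adjoin_induction with
    | mem a ha =>
      obtain ⟨i, rfl⟩ := ha
      exact ⟨1, _, affine_mem_polyFun 0 (EuclideanSpace.single i 1), fun x => by
        simp [c, EuclideanSpace.inner_single_left]⟩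
    | algebraMap s => exact ⟨0, _, const_mem_polyFun s, fun x => by simp⟩
    | add a b _ _ h1 h2 =>
      obtain ⟨m, p, hp, hp'⟩ := h1
      obtain ⟨n, q, hq, hq'⟩ := h2
      exact ⟨max m n, _, add_mem_polyFun (polyFun_mono (by simp) hp)
        (polyFun_mono (by simp) hq), fun x => by simp [hp', hq']⟩
    | mul a b _ _ h1 h2 =>
      obtain ⟨m, p, hp, hp'⟩ := h1
      obtain ⟨n, q, hq, hq'⟩ := h2
      exact ⟨m + n, _, by rw [Nat.cast_add]; exact mul_mem_polyFun hp hq,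
        fun x => by simp [hp', hq']⟩
  let fK : C(Metric.closedBall (0 : E d) r, ℝ) := ⟨fun x => f x.1, by fun_prop⟩
  obtain ⟨⟨a, ha⟩, hfa⟩ := ContinuousMap.exists_mem_subalgebra_near_continuousMap_of_separatesPoints
    A hA fK ε hε
  obtain ⟨n, p, hp, hap⟩ := hrep a ha
  refine ⟨n, p, hp, fun x hx => ?_⟩
  have h := (ContinuousMap.norm_coe_le_norm (a - fK) ⟨x, hx⟩).trans hfa.le
  rw [abs_sub_comm]
  simpa [fK, hap] using h

lemma exists_continuous_eqOn {d : ℕ} {s : Set (E d)} (hs : IsClosed s) {f : E d → ℝ}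
    (hf : ContinuousOn f s) : ∃ g : E d → ℝ, Continuous g ∧ ∀ x ∈ s, g x = f x := by
  obtain ⟨g, hg⟩ := ContinuousMap.exists_restrict_eq hs ⟨s.domRestrict f, hf.domRestrict⟩
  exact ⟨g, g.continuous, fun x hx => congrArg (fun h => h ⟨x, hx⟩) hg⟩

lemma exists_strongPair {d : ℕ} {R : Finset (E d)} (hR0 : ∀ α ∈ R, α ≠ 0) {k : E d → ℝ}
    (hkpos : ∀ α ∈ R, 0 < k α) (hm : 2 < (d : ℝ) + ∑ α ∈ R, k α) {r : ℝ} (hr : 0 < r)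
    {f g : E d → ℝ} (hf : Continuous f) (hg : Continuous g) :
    ∃ u : E d → ℝ, Continuous u ∧ StrongPair R k r u g ∧
      ∀ x ∈ Metric.sphere (0 : E d) r, u x = f x := by
  set ε : ℕ → ℝ := fun n => 1 / ((n : ℝ) + 1) with hε
  have hε0 : ∀ n, 0 < ε n := fun n => by positivity
  have hεlim : Tendsto ε atTop (𝓝 0) := tendsto_one_div_add_atTop_nhds_zero_nat
  have hstep : ∀ n : ℕ, ∃ u G, IsPolyPair R k u G ∧
      (∀ x ∈ Metric.sphere (0 : E d) r, |f x - u x| ≤ ε n) ∧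
      (∀ x ∈ Metric.closedBall (0 : E d) r, |g x - G x| ≤ ε n) := by
    intro n
    obtain ⟨a, p, hp, hfp⟩ := exists_poly_approx r hf (hε0 n)
    obtain ⟨b, G, hG, hgG⟩ := exists_poly_approx r hg (hε0 n)
    obtain ⟨P, hP, hpP⟩ := exists_dunklLap_mem_polyFun hR0 k hp
    have hpP : IsPolyPair R k p P := ⟨⟨_, hp⟩, ⟨_, hP⟩, hpP⟩
    have hH : (fun x => G x + (-1) * P x) ∈ polyFun d ((max a b : ℕ) : ℤ) :=
      add_mem_polyFun (polyFun_mono (by simp) hG)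
        (const_mul_mem_polyFun _ (polyFun_mono (by push_cast; omega) hP))
    obtain ⟨q, -, hq⟩ := exists_poisson_poly hR0 hkpos hm hr hH
    refine ⟨_, _, hpP.add hq, fun x hx => ?_, fun x hx => ?_⟩
    · have : ‖x‖ = r := by simpa using hx
      simpa [this] using hfp x (Metric.sphere_subset_closedBall hx)
    · simpa using hgG x hx
  choose u G hpair hu hG using hstep
  have hC : (0 : ℝ) < 1 + r ^ 2 := by positivity
  have hdist : ∀ m n, ∀ x ∈ Metric.closedBall (0 : E d) r,
      |u m x - u n x| ≤ (ε m + ε n) * (1 + r ^ 2) := by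
    intro m n x hx
    have h := (((hpair m).strongPair r).sub ((hpair n).strongPair r)).abs_le hR0 hkpos hm hr
      (a := ε m + ε n) (c := ε m + ε n) (by linarith [hε0 m, hε0 n]) (by linarith [hε0 m, hε0 n])
      (fun y hy => by
        have h1 := abs_le.1 (hu m y hy)
        have h2 := abs_le.1 (hu n y hy)
        exact abs_le.2 ⟨by linarith, by linarith⟩)
      (fun y hy => by
        have h1 := abs_le.1 (hG m y (Metric.ball_subset_closedBall hy))
        have h2 := abs_le.1 (hG n y (Metric.ball_subset_closedBall hy))
        exact abs_le.2 ⟨by linarith, by linarith⟩) x hx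
    linarith
  have hlim : ∀ x ∈ Metric.closedBall (0 : E d) r, ∃ l, Tendsto (fun n => u n x) atTop (𝓝 l) := by
    intro x hx
    apply cauchySeq_tendsto_of_complete
    refine cauchySeq_of_le_tendsto_0' (fun n => 2 * ε n * (1 + r ^ 2)) (fun n m hnm => ?_) ?_
    · rw [Real.dist_eq]
      refine (hdist n m x hx).trans ?_
      have : ε m ≤ ε n := by
        simp only [hε]
        gcongr
      gcongr
      linarith
    · simpa using (hεlim.const_mul 2).mul_const (1 + r ^ 2)
  choose! U hU using hlim
  have hUn : ∀ n, ∀ x ∈ Metric.closedBall (0 : E d) r, |U x - u n x| ≤ ε n * (1 + r ^ 2) := by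
    intro n x hx
    have h1 : Tendsto (fun m => |u m x - u n x|) atTop (𝓝 |U x - u n x|) :=
      ((hU x hx).sub_const _).abs
    have h2 : Tendsto (fun m => (ε m + ε n) * (1 + r ^ 2)) atTop (𝓝 (ε n * (1 + r ^ 2))) := by
      simpa using (hεlim.add_const (ε n)).mul_const (1 + r ^ 2)
    exact le_of_tendsto_of_tendsto' h1 h2 fun m => hdist m n x hx
  have hUlim : ∀ δ > 0, ∀ᶠ n in atTop, ε n * (1 + r ^ 2) < δ := by
    intro δ hδ
    have := hεlim.mul_const (1 + r ^ 2)
    rw [zero_mul] at this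
    exact this.eventually_lt_const hδ
  have hUc : ContinuousOn U (Metric.closedBall (0 : E d) r) := by
    have hunif : TendstoUniformlyOn u U atTop (Metric.closedBall (0 : E d) r) := by
      rw [Metric.tendstoUniformlyOn_iff]
      intro δ hδ
      filter_upwards [hUlim δ hδ] with n hn x hx
      rw [Real.dist_eq]
      exact (hUn n x hx).trans_lt hn
    exact hunif.continuousOn (Frequently.of_forall fun n => (hpair n).continuous_left.continuousOn)
  obtain ⟨V, hV, hVU⟩ := exists_continuous_eqOn Metric.isClosed_closedBall hUc
  refine ⟨V, hV, ?_, fun x hx => ?_⟩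
  · refine StrongPair.congr (v := U) (g := g) ?_ (fun x hx => (hVU x hx).symm) fun _ _ => rfl
    intro δ hδ
    obtain ⟨n, hn⟩ := (hUlim δ hδ).exists
    refine ⟨u n, G n, hpair n, fun x hx => ⟨(hUn n x hx).trans hn.le, (hG n x hx).trans ?_⟩⟩
    have := hε0 n
    nlinarith [sq_nonneg r]
  · have hxK := Metric.sphere_subset_closedBall hx
    rw [hVU x hxK]
    refine tendsto_nhds_unique (hU x hxK) ?_
    rw [tendsto_iff_dist_tendsto_zero]
    refine squeeze_zero (fun _ => dist_nonneg) (fun n => ?_) hεlim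
    rw [dist_comm, Real.dist_eq]
    exact hu n x hx

lemma StrongPair.sub_le_of_monotone {d : ℕ} {R : Finset (E d)} (hR0 : ∀ α ∈ R, α ≠ 0)
    {k : E d → ℝ} (hkpos : ∀ α ∈ R, 0 < k α) (hm : 2 < (d : ℝ) + ∑ α ∈ R, k α) {r : ℝ}
    (hr : 0 < r) {Φ : ℝ → ℝ} (hΦ : Monotone Φ) {t : ℝ} (ht : 0 ≤ t) {u₁ u₂ g₁ g₂ : E d → ℝ}
    (h₁ : StrongPair R k r u₁ (fun x => t * Φ (u₁ x) + g₁ x))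
    (h₂ : StrongPair R k r u₂ (fun x => t * Φ (u₂ x) + g₂ x))
    (hs : ∀ x ∈ Metric.sphere (0 : E d) r, u₁ x = u₂ x) {c : ℝ} (hc : 0 ≤ c)
    (hg : ∀ x ∈ Metric.closedBall (0 : E d) r, |g₁ x - g₂ x| ≤ c) :
    ∀ x ∈ Metric.closedBall (0 : E d) r, u₁ x - u₂ x ≤ c * r ^ 2 := by
  intro x hx
  have h := (h₁.sub h₂).le hR0 hkpos hm hr le_rfl hc (fun y hy => by simp [hs y hy])
    (fun y hy hpos => by
      have h3 : Φ (u₂ y) ≤ Φ (u₁ y) := hΦ (by linarith)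
      have h4 := (_root_.abs_le.1 (hg y (Metric.ball_subset_closedBall hy))).1
      nlinarith [mul_le_mul_of_nonneg_left h3 ht]) x hx
  simpa using h

lemma exists_strongPair_of_monotone_of_lipschitz {d : ℕ} {R : Finset (E d)}
    (hR0 : ∀ α ∈ R, α ≠ 0) {k : E d → ℝ} (hkpos : ∀ α ∈ R, 0 < k α)
    (hm : 2 < (d : ℝ) + ∑ α ∈ R, k α) {r : ℝ} (hr : 0 < r) {Φ : ℝ → ℝ} (hΦ : Monotone Φ)
    {L : NNReal} (hL : LipschitzWith L Φ) {f : E d → ℝ} (hf : Continuous f) :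
    ∃ u : E d → ℝ, Continuous u ∧ StrongPair R k r u (fun x => Φ (u x)) ∧
      ∀ x ∈ Metric.sphere (0 : E d) r, u x = f x := by
  obtain ⟨N, hN⟩ := exists_nat_gt ((L : ℝ) * r ^ 2)
  have hN0 : (0 : ℝ) < N := lt_of_le_of_lt (by positivity) hN
  set δ : ℝ := 1 / N with hδ
  have hδ0 : 0 < δ := by positivity
  have hδL : δ * L * r ^ 2 < 1 := by
    rw [hδ, div_mul_eq_mul_div, div_mul_eq_mul_div, div_lt_one hN0]
    linarith
  have hmain : ∀ j : ℕ, ∀ g : E d → ℝ, Continuous g → ∃ u : E d → ℝ, Continuous u ∧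
      StrongPair R k r u (fun x => (j * δ) * Φ (u x) + g x) ∧
      ∀ x ∈ Metric.sphere (0 : E d) r, u x = f x := by
    intro j
    induction j with
    | zero =>
      intro g hg
      simpa using exists_strongPair hR0 hkpos hm hr hf hg
    | succ j ih =>
      intro g hg
      have hext : ∀ w : C(Metric.closedBall (0 : E d) r, ℝ), ∃ W : E d → ℝ, Continuous W ∧
          ∀ x, W x.1 = w x := by
        intro w
        obtain ⟨W, hW⟩ := ContinuousMap.exists_restrict_eq Metric.isClosed_closedBall w
        exact ⟨W, W.continuous, fun x => congrArg (fun h => h x) hW⟩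
      choose W hWc hW using hext
      have hsol : ∀ w : C(Metric.closedBall (0 : E d) r, ℝ), ∃ u : E d → ℝ, Continuous u ∧
          StrongPair R k r u (fun x => (j * δ) * Φ (u x) + (g x + δ * Φ (W w x))) ∧
          ∀ x ∈ Metric.sphere (0 : E d) r, u x = f x := fun w =>
        ih _ (hg.add (continuous_const.mul (hL.continuous.comp (hWc w))))
      choose u huc hu huf using hsol
      let T : C(Metric.closedBall (0 : E d) r, ℝ) → C(Metric.closedBall (0 : E d) r, ℝ) :=
        fun w => ⟨fun x => u w x.1, (huc w).comp continuous_subtype_val⟩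
      have hkey : ∀ w₁ w₂, ∀ x ∈ Metric.closedBall (0 : E d) r,
          u w₁ x - u w₂ x ≤ δ * L * dist w₁ w₂ * r ^ 2 := by
        intro w₁ w₂
        refine (hu w₁).sub_le_of_monotone hR0 hkpos hm hr hΦ (by positivity) (hu w₂)
          (fun x hx => by rw [huf _ x hx, huf _ x hx]) (by positivity) fun x hx => ?_
        have h1 : |Φ (W w₁ x) - Φ (W w₂ x)| ≤ L * dist w₁ w₂ := by
          have h2 := hL.dist_le_mul (W w₁ x) (W w₂ x)
          rw [Real.dist_eq] at h2
          refine h2.trans ?_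
          gcongr
          rw [hW w₁ ⟨x, hx⟩, hW w₂ ⟨x, hx⟩]
          exact ContinuousMap.dist_apply_le_dist _
        have h3 : g x + δ * Φ (W w₁ x) - (g x + δ * Φ (W w₂ x)) =
            δ * (Φ (W w₁ x) - Φ (W w₂ x)) := by ring
        rw [h3, abs_mul, abs_of_pos hδ0, mul_assoc]
        gcongr
      have hT : ContractingWith (δ * L * r ^ 2).toNNReal T := by
        refine ⟨by simpa using hδL, LipschitzWith.of_dist_le_mul fun w₁ w₂ => ?_⟩
        rw [Real.coe_toNNReal _ (by positivity), ContinuousMap.dist_le (by positivity)]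
        intro x
        rw [Real.dist_eq, abs_le]
        have h1 := hkey w₁ w₂ x.1 x.2
        have h2 := hkey w₂ w₁ x.1 x.2
        rw [dist_comm] at h2
        simp only [T, ContinuousMap.coe_mk]
        constructor <;> linarith
      have hfix := hT.fixedPoint_isFixedPt
      set w := hT.fixedPoint T
      refine ⟨u w, huc w, (hu w).congr (fun _ _ => rfl) fun x hx => ?_, huf w⟩
      have h1 : W w x = u w x := by
        rw [hW w ⟨x, hx⟩]
        exact (congrArg (fun h => h ⟨x, hx⟩) hfix.eq).symm
      rw [h1]
      push_cast
      ring
  obtain ⟨u, huc, hu, huf⟩ := hmain N (fun _ => 0) continuous_const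
  refine ⟨u, huc, hu.congr (fun _ _ => rfl) fun x _ => ?_, huf⟩
  rw [hδ, mul_one_div_cancel hN0.ne']
  ring

lemma exists_strongPair_semilinear {d : ℕ} {R : Finset (E d)}
    (hR0 : ∀ α ∈ R, α ≠ 0) {k : E d → ℝ} (hkpos : ∀ α ∈ R, 0 < k α)
    (hm : 2 < (d : ℝ) + ∑ α ∈ R, k α) {r : ℝ} (hr : 0 < r) {φ : ℝ → ℝ} (hφ0 : φ 0 = 0)
    (hφmono : MonotoneOn φ (Set.Ici 0)) (hφlip : LocallyLipschitzOn (Set.Ici 0) φ)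
    {f : E d → ℝ} (hf : Continuous f) (hf0 : ∀ x ∈ Metric.sphere (0 : E d) r, 0 ≤ f x) :
    ∃ u : E d → ℝ, Continuous u ∧ StrongPair R k r u (fun x => φ (u x)) ∧
      (∀ x ∈ Metric.closedBall (0 : E d) r, 0 ≤ u x) ∧
      ∀ x ∈ Metric.sphere (0 : E d) r, u x = f x := by
  obtain ⟨M, hM0, hM⟩ : ∃ M, 0 ≤ M ∧ ∀ x ∈ Metric.sphere (0 : E d) r, f x ≤ M := by
    obtain ⟨M, hM⟩ := (isCompact_sphere (0 : E d) r).bddAbove_image hf.continuousOn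
    exact ⟨max M 0, le_max_right _ _, fun x hx =>
      (hM (Set.mem_image_of_mem f hx)).trans (le_max_left _ _)⟩
  have hφlipM : LocallyLipschitzOn (Set.Icc 0 M) φ := hφlip.mono Set.Icc_subset_Ici_self
  obtain ⟨L, hL⟩ := hφlipM.exists_lipschitzOnWith_of_compact isCompact_Icc
  set Φ : ℝ → ℝ := Set.IccExtend hM0 (fun t => φ t) with hΦdef
  have hΦmono : Monotone Φ := Monotone.IccExtend hM0 fun a b hab =>
    hφmono a.2.1 b.2.1 hab
  have hΦlip : LipschitzWith L Φ := by
    have h1 : LipschitzWith L (fun t : Set.Icc 0 M => φ t) := lipschitzOnWith_iff_restrict.1 hL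
    have h2 := h1.comp (LipschitzWith.projIcc hM0)
    rwa [mul_one] at h2
  have hΦeq : ∀ t, 0 ≤ t → t ≤ M → Φ t = φ t := fun t h0 h1 =>
    Set.IccExtend_of_mem hM0 (fun t => φ t) ⟨h0, h1⟩
  have hΦ0 : ∀ t ≤ 0, Φ t = 0 := fun t ht => by
    rw [hΦdef, Set.IccExtend_of_le_left hM0 _ ht]
    exact hφ0
  obtain ⟨u, huc, hu, huf⟩ := exists_strongPair_of_monotone_of_lipschitz hR0 hkpos hm hr hΦmono
    hΦlip hf
  have hu0 : ∀ x ∈ Metric.closedBall (0 : E d) r, 0 ≤ u x := by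
    intro x hx
    have := (hu.const_mul (-1)).max_principle hR0 hkpos hm hr
      (fun y hy => by rw [huf y hy]; linarith [hf0 y hy])
      (fun y _ hy => by rw [hΦ0 _ (by linarith)]; simp) x hx
    linarith
  have huM : ∀ x ∈ Metric.closedBall (0 : E d) r, u x ≤ M := by
    intro x hx
    have := (hu.add ((isPolyPair_const R k (-M)).strongPair r)).max_principle hR0 hkpos hm hr
      (fun y hy => by rw [huf y hy]; linarith [hM y hy])
      (fun y _ hy => by
        have : Φ 0 ≤ Φ (u y) := hΦmono (by linarith)
        rw [hΦ0 0 le_rfl] at this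
        simpa using this) x hx
    linarith
  exact ⟨u, huc, hu.congr (fun _ _ => rfl) fun x hx => hΦeq _ (hu0 x hx) (huM x hx), hu0, huf⟩

lemma intervalIntegrable_abs_rpow {s : ℝ} (hs : -1 < s) (r : ℝ) :
    IntervalIntegrable (fun t : ℝ => |t| ^ s) volume (-r) r := by
  have h0 : ∀ b : ℝ, 0 ≤ b → IntervalIntegrable (fun t : ℝ => |t| ^ s) volume 0 b := by
    intro b hb
    refine (intervalIntegral.intervalIntegrable_rpow' (a := 0) (b := b) hs).congr fun t ht => ?_
    rw [Set.uIoc_of_le hb] at ht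
    simp [abs_of_pos ht.1]
  have h1 : ∀ b : ℝ, IntervalIntegrable (fun t : ℝ => |t| ^ s) volume 0 b := by
    intro b
    rcases le_total 0 b with hb | hb
    · exact h0 b hb
    · rw [IntervalIntegrable.iff_comp_neg]
      simpa using h0 (-b) (by linarith)
  exact (h1 (-r)).symm.trans (h1 r)

lemma integrableOn_abs_inner_rpow {d : ℕ} {α : E d} (hα : α ≠ 0) {s : ℝ} (hs : -1 < s) (r : ℝ) :
    IntegrableOn (fun x : E d => |⟪x, α⟫| ^ s) (Metric.closedBall 0 r) := by
  rcases lt_or_ge r 0 with hr | hr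
  · simp [Metric.closedBall_eq_empty.2 hr]
  have hα' : 0 < ‖α‖ := norm_pos_iff.2 hα
  have hd : 0 < d := by
    rcases Nat.eq_zero_or_pos d with rfl | h
    · exact absurd (Subsingleton.elim α 0) hα
    · exact h
  let i₀ : Fin d := ⟨0, hd⟩
  obtain ⟨b, hb⟩ : ∃ b : OrthonormalBasis (Fin d) ℝ (E d), b i₀ = (‖α‖⁻¹ : ℝ) • α := by
    have hv : Orthonormal ℝ (({i₀} : Set (Fin d)).domRestrict
        (fun _ => (‖α‖⁻¹ : ℝ) • α : Fin d → E d)) := by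
      refine ⟨fun i => by simp [norm_smul, hα'.ne'], fun i j hij => ?_⟩
      exact absurd (Subsingleton.elim i j) hij
    obtain ⟨b, hb⟩ := hv.exists_orthonormalBasis_extension_of_card_eq (by simp)
    exact ⟨b, hb i₀ rfl⟩
  let g : Fin d → ℝ → ℝ := fun i =>
    (Set.Icc (-r) r).indicator (fun t => if i = i₀ then |t| ^ s else 1)
  have hg : Integrable (fun y : Fin d → ℝ => ∏ i, g i (y i)) := by
    refine Integrable.fintype_prod fun i => ?_
    rw [integrable_indicator_iff measurableSet_Icc]
    by_cases hi : i = i₀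
    · simp only [hi, if_true]
      exact (intervalIntegrable_iff_integrableOn_Icc_of_le (by linarith)).1
        (intervalIntegrable_abs_rpow hs r)
    · simp only [hi, if_false]
      exact integrableOn_const (by simp)
  have hmp := (PiLp.volume_preserving_ofLp (Fin d)).comp b.measurePreserving_repr
  have hG := (hmp.integrable_comp hg.aestronglyMeasurable).2 hg
  refine ((hG.const_mul (‖α‖ ^ s)).integrableOn (s := Metric.closedBall 0 r)).congr_fun
    (fun x hx => ?_) measurableSet_closedBall
  have hx' : ‖x‖ ≤ r := by simpa using hx
  have hmem : ∀ i, b.repr x i ∈ Set.Icc (-r) r := by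
    intro i
    rw [Set.mem_Icc, ← abs_le, b.repr_apply_apply]
    calc |⟪b i, x⟫| ≤ ‖b i‖ * ‖x‖ := abs_real_inner_le_norm _ _
      _ ≤ r := by simpa using hx'
  have h1 : ∀ i, g i (b.repr x i) = if i = i₀ then |b.repr x i₀| ^ s else 1 := by
    intro i
    simp only [g, Set.indicator_of_mem (hmem i)]
    split_ifs with h
    · rw [h]
    · rfl
  have h2 : |⟪x, α⟫| = ‖α‖ * |b.repr x i₀| := by
    rw [b.repr_apply_apply, hb, inner_smul_left, abs_mul, real_inner_comm x α]
    simp only [conj_trivial, abs_inv, abs_norm]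
    rw [mul_inv_cancel_left₀ hα'.ne']
  simp only [Function.comp_apply]
  rw [h2, Real.mul_rpow (norm_nonneg _) (abs_nonneg _)]
  congr 1
  calc ∏ i, g i (b.repr x i) = ∏ i, if i = i₀ then |b.repr x i₀| ^ s else 1 :=
        Finset.prod_congr rfl fun i _ => h1 i
    _ = |b.repr x i₀| ^ s := by simp

lemma continuous_wk {d : ℕ} {R : Finset (E d)} {k : E d → ℝ} (hkpos : ∀ α ∈ R, 0 < k α) :
    Continuous (wk R k) := by
  unfold wk
  refine continuous_finsetProd _ fun α hα => ?_
  exact Continuous.rpow_const (by fun_prop) fun x => Or.inr (hkpos α hα).le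

lemma wk_nonneg {d : ℕ} (R : Finset (E d)) (k : E d → ℝ) (x : E d) : 0 ≤ wk R k x :=
  Finset.prod_nonneg fun _ _ => Real.rpow_nonneg (abs_nonneg _) _

lemma wk_pos {d : ℕ} {R : Finset (E d)} (k : E d → ℝ) {x : E d} (hx : x ∈ offWalls R) :
    0 < wk R k x :=
  Finset.prod_pos fun α hα => Real.rpow_pos_of_pos
    (abs_pos.2 (by rw [real_inner_comm]; exact hx α hα)) _

lemma wk_eq_mul_erase {d : ℕ} {R : Finset (E d)} (k : E d → ℝ) {α : E d} (hα : α ∈ R) (x : E d) :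
    wk R k x = |⟪x, α⟫| ^ (k α) * wk (R.erase α) k x :=
  (Finset.mul_prod_erase R (fun α => |⟪x, α⟫| ^ (k α)) hα).symm

lemma wk_dunklReflect {d : ℕ} {R : Finset (E d)} (hR0 : ∀ α ∈ R, α ≠ 0)
    (hRrefl : ∀ α ∈ R, ∀ β ∈ R, dunklReflect α β ∈ R) {k : E d → ℝ}
    (hkinv : ∀ α ∈ R, ∀ β ∈ R, k (dunklReflect α β) = k β) {α : E d} (hα : α ∈ R) (x : E d) :
    wk R k (dunklReflect α x) = wk R k x := by
  unfold wk
  refine Finset.prod_nbij' (dunklReflect α) (dunklReflect α) (fun β hβ => hRrefl α hα β hβ)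
    (fun β hβ => hRrefl α hα β hβ) (fun β _ => dunklReflect_dunklReflect (hR0 α hα) β)
    (fun β _ => dunklReflect_dunklReflect (hR0 α hα) β) fun β hβ => ?_
  rw [hkinv α hα β hβ, inner_dunklReflect_comm]

lemma measurePreserving_dunklReflect {d : ℕ} (α : E d) :
    MeasurePreserving (dunklReflect α) volume volume ∧ MeasurableEmbedding (dunklReflect α) := by
  have h : dunklReflect α = ((ℝ ∙ α)ᗮ).reflection := by
    funext x
    rw [Submodule.reflection_orthogonal_apply, Submodule.reflection_singleton_apply, dunklReflect]
    rw [two_smul, ← add_smul]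
    simp only [RCLike.ofReal_real_eq_id, id]
    rw [neg_sub]
    congr 2
    ring
  rw [h]
  exact ⟨((ℝ ∙ α)ᗮ).reflection.measurePreserving,
    ((ℝ ∙ α)ᗮ).reflection.toHomeomorph.measurableEmbedding⟩

lemma integrableOn_div_inner {d : ℕ} {R : Finset (E d)} (hR0 : ∀ α ∈ R, α ≠ 0) {k : E d → ℝ}
    (hkpos : ∀ α ∈ R, 0 < k α) {α : E d} (hα : α ∈ R) (r : ℝ) :
    IntegrableOn (fun x : E d => wk R k x / |⟪α, x⟫|) (Metric.closedBall 0 r) := by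
  have h1 := integrableOn_abs_inner_rpow (hR0 α hα) (s := k α - 1) (by linarith [hkpos α hα]) r
  have h2 : Continuous (wk (R.erase α) k) :=
    continuous_wk fun β hβ => hkpos β (Finset.mem_of_mem_erase hβ)
  have h3 := h1.mul_continuousOn h2.continuousOn (isCompact_closedBall 0 r)
  refine h3.congr_fun_ae ?_
  refine ae_restrict_of_ae ?_
  filter_upwards [ae_inner_ne_zero (hR0 α hα)] with x hx
  have hx' : 0 < |⟪x, α⟫| := abs_pos.2 (by rwa [real_inner_comm])
  rw [wk_eq_mul_erase k hα, real_inner_comm x α, Real.rpow_sub_one hx'.ne']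
  ring

lemma integrableOn_mul_wk_of_le {d : ℕ} {R : Finset (E d)} (hR0 : ∀ α ∈ R, α ≠ 0) {k : E d → ℝ}
    (hkpos : ∀ α ∈ R, 0 < k α) {α : E d} (hα : α ∈ R) {r C : ℝ} {H : E d → ℝ}
    (hH : Measurable H) (hle : ∀ x ∈ Metric.closedBall (0 : E d) r, |H x| ≤ C / |⟪α, x⟫|) :
    IntegrableOn (fun x => H x * wk R k x) (Metric.closedBall 0 r) := by
  refine ((integrableOn_div_inner hR0 hkpos hα r).const_mul C).mono'
    (hH.mul (continuous_wk hkpos).measurable).aestronglyMeasurable ?_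
  filter_upwards [ae_restrict_mem measurableSet_closedBall] with x hx
  rw [norm_mul, Real.norm_eq_abs, Real.norm_of_nonneg (wk_nonneg R k x)]
  calc |H x| * wk R k x ≤ C / |⟪α, x⟫| * wk R k x :=
        mul_le_mul_of_nonneg_right (hle x hx) (wk_nonneg R k x)
    _ = C * (wk R k x / |⟪α, x⟫|) := by ring

/-- A smooth positive regularisation of the weight `wk`, tending to it as `ε → 0`. -/
def wkReg {d : ℕ} (R : Finset (E d)) (k : E d → ℝ) (ε : ℝ) (x : E d) : ℝ :=
  Real.exp (∑ α ∈ R, k α / 2 * Real.log (⟪α, x⟫ ^ 2 + ε))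

lemma contDiff_wkReg {d : ℕ} (R : Finset (E d)) (k : E d → ℝ) {ε : ℝ} (hε : 0 < ε)
    {n : WithTop ℕ∞} : ContDiff ℝ n (wkReg R k ε) := by
  unfold wkReg
  refine ContDiff.exp (ContDiff.sum fun α _ => contDiff_const.mul (ContDiff.log ?_ fun x => ?_))
  · exact ((contDiff_const.inner ℝ contDiff_id).pow 2).add contDiff_const
  · positivity

lemma fderiv_wkReg {d : ℕ} (R : Finset (E d)) (k : E d → ℝ) {ε : ℝ} (hε : 0 < ε) (x e : E d) :
    fderiv ℝ (wkReg R k ε) x e =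
      ∑ α ∈ R, k α * ⟪α, e⟫ * (wkReg R k ε x * (⟪α, x⟫ / (⟪α, x⟫ ^ 2 + ε))) := by
  have h1 : ∀ α ∈ R, HasFDerivAt (fun y : E d => k α / 2 * Real.log (⟪α, y⟫ ^ 2 + ε))
      ((k α / 2) • ((⟪α, x⟫ ^ 2 + ε)⁻¹ • ((2 * ⟪α, x⟫) • innerSL ℝ α))) x := by
    intro α _
    have h2 : HasFDerivAt (fun y : E d => ⟪α, y⟫) (innerSL ℝ α) x := (innerSL ℝ α).hasFDerivAt
    have h3 := ((h2.pow 2).add_const ε).log (by positivity)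
    simpa using h3.const_mul (k α / 2)
  have h := (HasFDerivAt.fun_sum h1).exp
  rw [show wkReg R k ε = fun y => Real.exp (∑ α ∈ R, k α / 2 * Real.log (⟪α, y⟫ ^ 2 + ε)) from rfl,
    h.fderiv]
  simp only [smul_apply, sum_apply, innerSL_apply_apply, smul_eq_mul,
    Finset.mul_sum]
  refine Finset.sum_congr rfl fun α _ => ?_
  field_simp

lemma wkReg_mono {d : ℕ} {R : Finset (E d)} {k : E d → ℝ} (hkpos : ∀ α ∈ R, 0 < k α) {ε δ : ℝ}
    (hε : 0 < ε) (h : ε ≤ δ) (x : E d) : wkReg R k ε x ≤ wkReg R k δ x := by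
  unfold wkReg
  gcongr with α hα
  have := hkpos α hα
  positivity

lemma wkReg_eq_mul_erase {d : ℕ} {R : Finset (E d)} (k : E d → ℝ) {ε : ℝ} (hε : 0 < ε) {α : E d}
    (hα : α ∈ R) (x : E d) :
    wkReg R k ε x = (⟪α, x⟫ ^ 2 + ε) ^ (k α / 2) * wkReg (R.erase α) k ε x := by
  unfold wkReg
  rw [← Finset.add_sum_erase R _ hα, Real.exp_add, Real.rpow_def_of_pos (by positivity), mul_comm
    (k α / 2)]

lemma tendsto_wkReg {d : ℕ} {R : Finset (E d)} (k : E d → ℝ) {x : E d} (hx : x ∈ offWalls R)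
    {ε : ℕ → ℝ} (hε : Tendsto ε atTop (𝓝 0)) :
    Tendsto (fun n => wkReg R k (ε n) x) atTop (𝓝 (wk R k x)) := by
  have h1 : wk R k x = Real.exp (∑ α ∈ R, k α / 2 * Real.log (⟪α, x⟫ ^ 2 + 0)) := by
    rw [Real.exp_sum, wk]
    refine Finset.prod_congr rfl fun α hα => ?_
    have h2 : 0 < |⟪α, x⟫| := abs_pos.2 (hx α hα)
    rw [real_inner_comm, Real.rpow_def_of_pos h2, add_zero, ← sq_abs, Real.log_pow]
    congr 1
    push_cast
    ring
  rw [h1]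
  refine (Real.continuous_exp.tendsto _).comp (tendsto_finsetSum _ fun α hα => ?_)
  refine Tendsto.const_mul _ (Tendsto.log (tendsto_const_nhds.add hε) ?_)
  have := hx α hα
  positivity

lemma rpow_mul_abs_div_le {κ t ε : ℝ} (ht : t ≠ 0) (hε : 0 < ε) (hε1 : ε ≤ 1) :
    (t ^ 2 + ε) ^ (κ / 2) * (|t| / (t ^ 2 + ε)) ≤ |t| ^ (κ - 1) + (t ^ 2 + 1) ^ (κ / 2) := by
  have hpos : 0 < t ^ 2 + ε := by positivity
  have ht' : 0 < |t| := abs_pos.2 ht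
  have h1 : (t ^ 2 + ε) ^ (κ / 2) * (|t| / (t ^ 2 + ε)) = (t ^ 2 + ε) ^ (κ / 2 - 1) * |t| := by
    rw [Real.rpow_sub_one hpos.ne']
    ring
  rw [h1]
  rcases le_total κ 2 with h | h
  · have h2 : (t ^ 2 + ε) ^ (κ / 2 - 1) ≤ (t ^ 2) ^ (κ / 2 - 1) :=
      Real.rpow_le_rpow_of_nonpos (by positivity) (by linarith) (by linarith)
    have h3 : (t ^ 2) ^ (κ / 2 - 1) * |t| = |t| ^ (κ - 1) := by
      rw [← sq_abs, ← Real.rpow_natCast, ← Real.rpow_mul ht'.le]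
      nth_rw 2 [← Real.rpow_one |t|]
      rw [← Real.rpow_add ht']
      congr 1
      push_cast
      ring
    have h4 : 0 ≤ (t ^ 2 + 1) ^ (κ / 2) := by positivity
    nlinarith [mul_le_mul_of_nonneg_right h2 ht'.le]
  · have h2 : (t ^ 2 + ε) ^ (κ / 2 - 1) ≤ (t ^ 2 + 1) ^ (κ / 2 - 1) :=
      Real.rpow_le_rpow hpos.le (by linarith) (by linarith)
    have h3 : |t| ≤ t ^ 2 + 1 := by
      rw [← sq_abs]
      nlinarith [sq_nonneg (|t| - 1)]
    have h4 : (t ^ 2 + 1) ^ (κ / 2 - 1) * (t ^ 2 + 1) = (t ^ 2 + 1) ^ (κ / 2) := by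
      rw [Real.rpow_sub_one (by positivity)]
      field_simp
    have h5 : 0 ≤ |t| ^ (κ - 1) := by positivity
    calc (t ^ 2 + ε) ^ (κ / 2 - 1) * |t| ≤ (t ^ 2 + 1) ^ (κ / 2 - 1) * (t ^ 2 + 1) := by gcongr
      _ ≤ _ := by rw [h4]; linarith

lemma HasCompactSupport.exists_closedBall {d : ℕ} {F : E d → ℝ} (hF : HasCompactSupport F) :
    ∃ ρ : ℝ, ∀ x, x ∉ Metric.closedBall (0 : E d) ρ → F x = 0 := by
  obtain ⟨ρ, hρ⟩ := hF.isCompact.isBounded.subset_closedBall 0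
  exact ⟨ρ, fun x hx => image_eq_zero_of_notMem_tsupport fun h => hx (hρ h)⟩

lemma integrable_mul_of_closedBall {d : ℕ} {F G : E d → ℝ} (hFc : Continuous F) {ρ : ℝ}
    (hF : ∀ x, x ∉ Metric.closedBall (0 : E d) ρ → F x = 0)
    (hG : IntegrableOn G (Metric.closedBall 0 ρ)) : Integrable (fun x => F x * G x) := by
  have h := hG.continuousOn_mul hFc.continuousOn (isCompact_closedBall 0 ρ)
  refine (integrableOn_iff_integrable_of_support_subset fun x hx => ?_).1 h
  by_contra hx'
  exact hx (by simp [hF x hx'])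

lemma integrable_mul_wk {d : ℕ} {R : Finset (E d)} {k : E d → ℝ} (hkpos : ∀ α ∈ R, 0 < k α)
    {F : E d → ℝ} (hFc : Continuous F) (hF : HasCompactSupport F) :
    Integrable (fun x => F x * wk R k x) :=
  (hFc.mul (continuous_wk hkpos)).integrable_of_hasCompactSupport hF.mul_right

lemma tendsto_integral_mul_wkReg {d : ℕ} {R : Finset (E d)} (hR0 : ∀ α ∈ R, α ≠ 0) {k : E d → ℝ}
    (hkpos : ∀ α ∈ R, 0 < k α) {F : E d → ℝ} (hFc : Continuous F) (hF : HasCompactSupport F)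
    {ε : ℕ → ℝ} (hε : Tendsto ε atTop (𝓝 0)) (hε0 : ∀ n, 0 < ε n) (hε1 : ∀ n, ε n ≤ 1) :
    Tendsto (fun n => ∫ x, F x * wkReg R k (ε n) x) atTop (𝓝 (∫ x, F x * wk R k x)) := by
  have hc : ∀ δ : ℝ, 0 < δ → Continuous (wkReg R k δ) := fun δ hδ =>
    (contDiff_wkReg R k hδ (n := 0)).continuous
  refine tendsto_integral_of_dominated_convergence (fun x => |F x| * wkReg R k 1 x)
    (fun n => (hFc.mul (hc _ (hε0 n))).aestronglyMeasurable)
    ((hFc.abs.mul (hc 1 one_pos)).integrable_of_hasCompactSupport hF.abs.mul_right)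
    (fun n => ae_of_all _ fun x => ?_) ?_
  · have h0 : 0 ≤ wkReg R k (ε n) x := (Real.exp_pos _).le
    rw [norm_mul, Real.norm_eq_abs, Real.norm_of_nonneg h0]
    gcongr
    exact wkReg_mono hkpos (hε0 n) (hε1 n) x
  · filter_upwards [ae_offWalls hR0] with x hx
    exact (tendsto_wkReg k hx hε).const_mul _

lemma tendsto_integral_mul_wkReg_div {d : ℕ} {R : Finset (E d)} (hR0 : ∀ α ∈ R, α ≠ 0)
    {k : E d → ℝ} (hkpos : ∀ α ∈ R, 0 < k α) {α : E d} (hα : α ∈ R) {F : E d → ℝ}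
    (hFc : Continuous F) (hF : HasCompactSupport F)
    {ε : ℕ → ℝ} (hε : Tendsto ε atTop (𝓝 0)) (hε0 : ∀ n, 0 < ε n) (hε1 : ∀ n, ε n ≤ 1) :
    Tendsto (fun n => ∫ x, F x * (wkReg R k (ε n) x * (⟪α, x⟫ / (⟪α, x⟫ ^ 2 + ε n)))) atTop
      (𝓝 (∫ x, F x / ⟪α, x⟫ * wk R k x)) := by
  have hc : ∀ δ : ℝ, 0 < δ → Continuous (wkReg R k δ) := fun δ hδ =>
    (contDiff_wkReg R k hδ (n := 0)).continuous
  have hc1 : Continuous (wkReg (R.erase α) k 1) :=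
    (contDiff_wkReg (R.erase α) k one_pos (n := 0)).continuous
  obtain ⟨ρ, hρ⟩ := HasCompactSupport.exists_closedBall hF
  have hkα := hkpos α hα
  have hD : IntegrableOn (fun x : E d => (|⟪x, α⟫| ^ (k α - 1) + (⟪x, α⟫ ^ 2 + 1) ^ (k α / 2)) *
      wkReg (R.erase α) k 1 x) (Metric.closedBall 0 ρ) := by
    refine IntegrableOn.mul_continuousOn ?_ hc1.continuousOn (isCompact_closedBall 0 ρ)
    refine (integrableOn_abs_inner_rpow (hR0 α hα) (by linarith) ρ).add
      (ContinuousOn.integrableOn_compact (isCompact_closedBall 0 ρ) ?_)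
    exact (Continuous.rpow_const (by fun_prop) fun x => Or.inr (by linarith)).continuousOn
  refine tendsto_integral_of_dominated_convergence _ (fun n => ?_)
    (integrable_mul_of_closedBall hFc.abs (fun x hx => by simp [hρ x hx]) hD)
    (fun n => ?_) ?_
  · refine Continuous.aestronglyMeasurable (hFc.mul ((hc _ (hε0 n)).mul (Continuous.div ?_ ?_ ?_)))
    · fun_prop
    · fun_prop
    · intro x
      have := hε0 n
      positivity
  · filter_upwards [ae_offWalls hR0] with x hx
    have hεn := hε0 n
    have h0 : 0 < wkReg (R.erase α) k (ε n) x := Real.exp_pos _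
    have h1 := rpow_mul_abs_div_le (κ := k α) (hx α hα) hεn (hε1 n)
    have h2 : wkReg (R.erase α) k (ε n) x ≤ wkReg (R.erase α) k 1 x :=
      wkReg_mono (fun β hβ => hkpos β (Finset.mem_of_mem_erase hβ)) hεn (hε1 n) x
    rw [wkReg_eq_mul_erase k hεn hα, real_inner_comm α x, norm_mul, Real.norm_eq_abs]
    gcongr
    rw [norm_mul, norm_mul, norm_div, Real.norm_of_nonneg h0.le,
      Real.norm_of_nonneg (by positivity : (0 : ℝ) ≤ (⟪α, x⟫ ^ 2 + ε n) ^ (k α / 2)),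
      Real.norm_of_nonneg (by positivity : (0 : ℝ) ≤ ⟪α, x⟫ ^ 2 + ε n), Real.norm_eq_abs,
      mul_right_comm]
    gcongr
  · filter_upwards [ae_offWalls hR0] with x hx
    have h1 := hx α hα
    have h2 : F x / ⟪α, x⟫ * wk R k x = F x * (wk R k x * (⟪α, x⟫ / (⟪α, x⟫ ^ 2 + 0))) := by
      field_simp
      ring
    rw [h2]
    refine ((tendsto_wkReg k hx hε).mul (Tendsto.div tendsto_const_nhds
      (tendsto_const_nhds.add hε) ?_)).const_mul _
    positivity

lemma sum_integral_div_inner_mul_wk {d : ℕ} {R : Finset (E d)} (hR0 : ∀ α ∈ R, α ≠ 0)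
    {k : E d → ℝ} (hkpos : ∀ α ∈ R, 0 < k α) {F : E d → ℝ} (hFc : ContDiff ℝ 1 F)
    (hF : HasCompactSupport F) (e : E d) :
    ∑ α ∈ R, k α * ⟪α, e⟫ * ∫ x, F x / ⟪α, x⟫ * wk R k x = -∫ x, fderiv ℝ F x e * wk R k x := by
  set ε : ℕ → ℝ := fun n => 1 / ((n : ℝ) + 1)
  have hε0 : ∀ n, 0 < ε n := fun n => by positivity
  have hε1 : ∀ n, ε n ≤ 1 := fun n => by
    rw [div_le_one (by positivity)]
    linarith [n.cast_nonneg (α := ℝ)]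
  have hε : Tendsto ε atTop (𝓝 0) := tendsto_one_div_add_atTop_nhds_zero_nat
  have hF'c : Continuous fun x => fderiv ℝ F x e := by
    have := hFc.continuous_fderiv one_ne_zero
    fun_prop
  have hF' : HasCompactSupport fun x => fderiv ℝ F x e := hF.fderiv_apply ℝ e
  have hL := tendsto_finsetSum R fun α hα =>
    (tendsto_integral_mul_wkReg_div hR0 hkpos hα hFc.continuous hF hε hε0 hε1).const_mul
      (k α * ⟪α, e⟫)
  have hRt := (tendsto_integral_mul_wkReg hR0 hkpos hF'c hF' hε hε0 hε1).neg
  refine tendsto_nhds_unique hL (hRt.congr fun n => ?_)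
  have hw : ContDiff ℝ 1 (wkReg R k (ε n)) := contDiff_wkReg R k (hε0 n)
  have hwc := hw.continuous
  have hw'c : Continuous fun x => fderiv ℝ (wkReg R k (ε n)) x e := by
    have := hw.continuous_fderiv one_ne_zero
    fun_prop
  rw [← integral_mul_fderiv_eq_neg_fderiv_mul_of_integrable
    ((hF'c.mul hwc).integrable_of_hasCompactSupport hF'.mul_right)
    ((hFc.continuous.mul hw'c).integrable_of_hasCompactSupport hF.mul_right)
    ((hFc.continuous.mul hwc).integrable_of_hasCompactSupport hF.mul_right)
    (fun x _ => (hFc.differentiable one_ne_zero).differentiableAt)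
    (fun x _ => (hw.differentiable one_ne_zero).differentiableAt)]
  simp_rw [fderiv_wkReg R k (hε0 n), Finset.mul_sum]
  rw [integral_finsetSum]
  · refine Finset.sum_congr rfl fun α _ => ?_
    rw [← integral_const_mul]
    congr 1
    funext x
    ring
  · intro α _
    refine Continuous.integrable_of_hasCompactSupport ?_ hF.mul_right
    refine hFc.continuous.mul (continuous_const.mul (hwc.mul (Continuous.div ?_ ?_ ?_)))
    · fun_prop
    · fun_prop
    · intro x
      have := hε0 n
      positivity

lemma contDiff_fderiv_apply {d : ℕ} {u : E d → ℝ} (hu : ContDiff ℝ 2 u) (e : E d) :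
    ContDiff ℝ 1 (fun x => fderiv ℝ u x e) :=
  (hu.fderiv_right (m := 1) (by norm_num)).clm_apply contDiff_const

lemma continuous_lap {d : ℕ} {u : E d → ℝ} (hu : ContDiff ℝ 2 u) : Continuous (lap u) := by
  rw [funext (lap_eq hu)]
  refine continuous_finsetSum _ fun i _ => ?_
  exact ((contDiff_fderiv_apply hu _).continuous_fderiv one_ne_zero).clm_apply continuous_const

lemma exists_abs_sub_dunklReflect_le {d : ℕ} {u : E d → ℝ} (hu : ContDiff ℝ 1 u) {α : E d}
    (hα : α ≠ 0) (r : ℝ) : ∃ C : ℝ, 0 ≤ C ∧ ∀ x ∈ Metric.closedBall (0 : E d) r,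
      |u x - u (dunklReflect α x)| ≤ C * |⟪α, x⟫| := by
  obtain ⟨K, hK⟩ := hu.contDiffOn.exists_lipschitzOnWith one_ne_zero
    (convex_closedBall (0 : E d) r) (isCompact_closedBall 0 r)
  have hα' : 0 < ‖α‖ := norm_pos_iff.2 hα
  refine ⟨K * (2 / ‖α‖), by positivity, fun x hx => ?_⟩
  have hσ : dunklReflect α x ∈ Metric.closedBall (0 : E d) r := by
    rw [mem_closedBall_zero_iff] at hx ⊢
    rwa [norm_dunklReflect hα]
  have h := hK.dist_le_mul x hx _ hσ
  rw [Real.dist_eq, dist_eq_norm] at h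
  refine h.trans_eq ?_
  rw [dunklReflect, sub_sub_cancel, norm_smul, norm_div, norm_mul, norm_pow, norm_norm,
    Real.norm_eq_abs, Real.norm_eq_abs, abs_two]
  field_simp

lemma exists_abs_dunklTerm_le {d : ℕ} {u : E d → ℝ} (hu : ContDiff ℝ 1 u) {α : E d} (hα : α ≠ 0)
    (r : ℝ) : ∃ C : ℝ, ∀ x ∈ Metric.closedBall (0 : E d) r,
      |dunklTerm α u x| ≤ C / |⟪α, x⟫| := by
  obtain ⟨C, -, hC⟩ := exists_abs_sub_dunklReflect_le hu hα r
  have hc : Continuous fun x => fderiv ℝ u x α :=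
    (hu.continuous_fderiv one_ne_zero).clm_apply continuous_const
  obtain ⟨D, hD⟩ := (isCompact_closedBall (0 : E d) r).exists_bound_of_continuousOn hc.continuousOn
  refine ⟨D + ‖α‖ ^ 2 / 2 * C, fun x hx => ?_⟩
  rcases eq_or_ne ⟪α, x⟫ 0 with h0 | h0
  · simp [dunklTerm, h0]
  have h0' : 0 < |⟪α, x⟫| := abs_pos.2 h0
  have h1 := hD x hx
  have h2 := hC x hx
  rw [Real.norm_eq_abs] at h1
  rw [dunklTerm, add_div]
  refine (abs_sub _ _).trans (add_le_add ?_ ?_)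
  · rw [abs_div]
    gcongr
  · rw [abs_mul, abs_of_nonneg (by positivity : (0 : ℝ) ≤ ‖α‖ ^ 2 / 2), mul_div_assoc, abs_div]
    refine mul_le_mul_of_nonneg_left ?_ (by positivity)
    rw [abs_pow, div_le_div_iff₀ (by positivity) h0']
    calc _ ≤ C * |⟪α, x⟫| * |⟪α, x⟫| := by gcongr
      _ = _ := by ring

lemma measurable_dunklTerm {d : ℕ} {u : E d → ℝ} (hu : ContDiff ℝ 1 u) (α : E d) :
    Measurable (dunklTerm α u) := by
  have hc : Continuous fun x => fderiv ℝ u x α :=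
    (hu.continuous_fderiv one_ne_zero).clm_apply continuous_const
  have h1 : Continuous fun x : E d => ⟪α, x⟫ := by fun_prop
  have h2 : Continuous fun x : E d => u x - u (dunklReflect α x) :=
    hu.continuous.sub (hu.continuous.comp (continuous_dunklReflect α))
  exact (hc.measurable.div h1.measurable).sub
    ((h2.measurable.div (h1.pow 2).measurable).const_mul _)

lemma integrableOn_dunklLap_mul_wk {d : ℕ} {R : Finset (E d)} (hR0 : ∀ α ∈ R, α ≠ 0) {k : E d → ℝ}
    (hkpos : ∀ α ∈ R, 0 < k α) {u : E d → ℝ} (hu : ContDiff ℝ 2 u) (r : ℝ) :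
    IntegrableOn (fun x => dunklLap R k u x * wk R k x) (Metric.closedBall 0 r) := by
  have h1 : ContDiff ℝ 1 u := hu.of_le (by norm_num)
  have h2 : (fun x => dunklLap R k u x * wk R k x) = fun x => lap u x * wk R k x +
      ∑ α ∈ R, k α * (dunklTerm α u x * wk R k x) := by
    funext x
    rw [dunklLap_eq, add_mul, Finset.sum_mul]
    simp only [mul_assoc]
  rw [h2]
  refine Integrable.add ?_ (integrable_finsetSum _ fun α hα => Integrable.const_mul ?_ _)
  · exact ((continuous_lap hu).mul (continuous_wk hkpos)).continuousOn.integrableOn_compact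
      (isCompact_closedBall 0 r)
  · obtain ⟨C, hC⟩ := exists_abs_dunklTerm_le h1 (hR0 α hα) r
    exact integrableOn_mul_wk_of_le hR0 hkpos hα (measurable_dunklTerm h1 α) hC

lemma integrableOn_mul_dunklLap_mul_wk {d : ℕ} {R : Finset (E d)} (hR0 : ∀ α ∈ R, α ≠ 0)
    {k : E d → ℝ} (hkpos : ∀ α ∈ R, 0 < k α) {u : E d → ℝ} (hu : ContDiff ℝ 2 u) {r : ℝ}
    {v : E d → ℝ} (hv : ContinuousOn v (Metric.closedBall 0 r)) :
    IntegrableOn (fun x => v x * dunklLap R k u x * wk R k x) (Metric.closedBall 0 r) := by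
  have h := (integrableOn_dunklLap_mul_wk hR0 hkpos hu r).continuousOn_mul hv
    (isCompact_closedBall 0 r)
  simpa only [mul_assoc] using h

lemma integrable_div_inner_mul_wk {d : ℕ} {R : Finset (E d)} (hR0 : ∀ α ∈ R, α ≠ 0) {k : E d → ℝ}
    (hkpos : ∀ α ∈ R, 0 < k α) {α : E d} (hα : α ∈ R) {F : E d → ℝ} (hFc : Continuous F)
    (hF : HasCompactSupport F) : Integrable (fun x => F x / ⟪α, x⟫ * wk R k x) := by
  obtain ⟨ρ, hρ⟩ := HasCompactSupport.exists_closedBall hF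
  have h1 : Measurable fun x : E d => ⟪α, x⟫⁻¹ := by
    have : Continuous fun x : E d => ⟪α, x⟫ := by fun_prop
    exact this.measurable.inv
  have h := integrable_mul_of_closedBall hFc hρ (integrableOn_mul_wk_of_le hR0 hkpos hα (C := 1)
    (r := ρ) h1 fun x _ => by rw [abs_inv, one_div])
  simpa only [div_eq_mul_inv, mul_assoc] using h

lemma integral_reflection_eq_zero {d : ℕ} {R : Finset (E d)} (hR0 : ∀ α ∈ R, α ≠ 0)
    (hRrefl : ∀ α ∈ R, ∀ β ∈ R, dunklReflect α β ∈ R) {k : E d → ℝ}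
    (hkinv : ∀ α ∈ R, ∀ β ∈ R, k (dunklReflect α β) = k β) {α : E d} (hα : α ∈ R)
    (p ψ : E d → ℝ) :
    ∫ x, (ψ x * p (dunklReflect α x) - p x * ψ (dunklReflect α x)) / ⟪α, x⟫ ^ 2 * wk R k x = 0 := by
  obtain ⟨h1, h2⟩ := measurePreserving_dunklReflect α
  have h := h1.integral_comp h2 fun x =>
    (ψ x * p (dunklReflect α x) - p x * ψ (dunklReflect α x)) / ⟪α, x⟫ ^ 2 * wk R k x
  have h3 : ∀ x, (ψ (dunklReflect α x) * p (dunklReflect α (dunklReflect α x)) -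
      p (dunklReflect α x) * ψ (dunklReflect α (dunklReflect α x))) /
        ⟪α, dunklReflect α x⟫ ^ 2 * wk R k (dunklReflect α x) =
      -((ψ x * p (dunklReflect α x) - p x * ψ (dunklReflect α x)) / ⟪α, x⟫ ^ 2 * wk R k x) := by
    intro x
    rw [dunklReflect_dunklReflect (hR0 α hα), inner_dunklReflect_self (hR0 α hα),
      wk_dunklReflect hR0 hRrefl hkinv hα]
    ring
  simp only [h3] at h
  rw [integral_neg] at h
  linarith

lemma integrable_reflection {d : ℕ} {R : Finset (E d)} (hR0 : ∀ α ∈ R, α ≠ 0) {k : E d → ℝ}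
    (hkpos : ∀ α ∈ R, 0 < k α) {α : E d} (hα : α ∈ R) {p ψ : E d → ℝ} (hp : ContDiff ℝ 1 p)
    (hψ : ContDiff ℝ 1 ψ) (hψc : HasCompactSupport ψ) :
    Integrable (fun x => (ψ x * p (dunklReflect α x) - p x * ψ (dunklReflect α x)) / ⟪α, x⟫ ^ 2 *
      wk R k x) := by
  obtain ⟨ρ, hρ⟩ := HasCompactSupport.exists_closedBall hψc
  obtain ⟨A, hA0, hA⟩ := exists_abs_sub_dunklReflect_le hp (hR0 α hα) ρ
  obtain ⟨B, hB0, hB⟩ := exists_abs_sub_dunklReflect_le hψ (hR0 α hα) ρ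
  obtain ⟨P, hP⟩ := (isCompact_closedBall (0 : E d) ρ).exists_bound_of_continuousOn
    hp.continuous.continuousOn
  obtain ⟨Q, hQ⟩ := (isCompact_closedBall (0 : E d) ρ).exists_bound_of_continuousOn
    hψ.continuous.continuousOn
  have hσ := continuous_dunklReflect α
  have hmeas : Measurable fun x =>
      (ψ x * p (dunklReflect α x) - p x * ψ (dunklReflect α x)) / ⟪α, x⟫ ^ 2 := by
    refine Measurable.div (Continuous.measurable ?_) (Continuous.measurable ?_)
    · exact (hψ.continuous.mul (hp.continuous.comp hσ)).sub
        (hp.continuous.mul (hψ.continuous.comp hσ))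
    · fun_prop
  have h := integrableOn_mul_wk_of_le hR0 hkpos hα (C := Q * A + P * B) (r := ρ) hmeas ?_
  · refine (integrableOn_iff_integrable_of_support_subset fun x hx => ?_).1 h
    by_contra hx'
    refine hx ?_
    have h1 : ψ (dunklReflect α x) = 0 := hρ _ (by
      rw [mem_closedBall_zero_iff] at hx' ⊢
      rwa [norm_dunklReflect (hR0 α hα)])
    simp [hρ x hx', h1]
  · intro x hx
    rcases eq_or_ne ⟪α, x⟫ 0 with h0 | h0
    · simp [h0]
    have h0' : 0 < |⟪α, x⟫| := abs_pos.2 h0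
    have h1 := hP x hx
    have h2 := hQ x hx
    rw [Real.norm_eq_abs] at h1 h2
    have h3 : ψ x * p (dunklReflect α x) - p x * ψ (dunklReflect α x) =
        p x * (ψ x - ψ (dunklReflect α x)) - ψ x * (p x - p (dunklReflect α x)) := by ring
    rw [abs_div, abs_pow, div_le_div_iff₀ (by positivity) h0', h3]
    have h4 : |p x * (ψ x - ψ (dunklReflect α x)) - ψ x * (p x - p (dunklReflect α x))| ≤
        P * (B * |⟪α, x⟫|) + Q * (A * |⟪α, x⟫|) := by
      refine (abs_sub _ _).trans (add_le_add ?_ ?_)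
      · rw [abs_mul]
        exact mul_le_mul h1 (hB x hx) (abs_nonneg _) ((abs_nonneg _).trans h1)
      · rw [abs_mul]
        exact mul_le_mul h2 (hA x hx) (abs_nonneg _) ((abs_nonneg _).trans h2)
    nlinarith [mul_le_mul_of_nonneg_right h4 h0'.le]

lemma dunklLap_eq_zero_of_notMem {d : ℕ} {R : Finset (E d)} (hR0 : ∀ α ∈ R, α ≠ 0) (k : E d → ℝ)
    {ψ : E d → ℝ} (hψ : ContDiff ℝ 2 ψ) {r : ℝ} (hsub : tsupport ψ ⊆ Metric.ball 0 r) {x : E d}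
    (hx : x ∉ Metric.ball (0 : E d) r) : dunklLap R k ψ x = 0 := by
  have h0 : ∀ e, (fun y => fderiv ℝ ψ y e) =ᶠ[𝓝 x] fun _ => 0 := by
    intro e
    have hopen : (tsupport ψ)ᶜ ∈ 𝓝 x := (isClosed_tsupport ψ).isOpen_compl.mem_nhds
      fun h => hx (hsub h)
    filter_upwards [hopen] with y hy
    rw [fderiv_of_notMem_tsupport ℝ hy]
    rfl
  have h1 : ∀ y, y ∉ Metric.ball (0 : E d) r → ψ y = 0 := fun y hy =>
    image_eq_zero_of_notMem_tsupport fun h => hy (hsub h)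
  rw [dunklLap_eq, lap_eq hψ]
  have h2 : ∀ i : Fin d, fderiv ℝ (fun y => fderiv ℝ ψ y (EuclideanSpace.single i 1)) x
      (EuclideanSpace.single i 1) = 0 := by
    intro i
    rw [(h0 _).fderiv_eq]
    simp
  have h3 : ∀ α ∈ R, dunklTerm α ψ x = 0 := by
    intro α hα
    have h4 : ψ (dunklReflect α x) = 0 := h1 _ (by
      rw [mem_ball_zero_iff] at hx ⊢
      rwa [norm_dunklReflect (hR0 α hα)])
    rw [dunklTerm, h4, h1 x hx, (h0 α).eq_of_nhds]
    simp
  rw [Finset.sum_eq_zero fun i _ => h2 i, Finset.sum_eq_zero fun α hα => by rw [h3 α hα, mul_zero],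
    add_zero]

lemma integral_mul_dunklLap_comm {d : ℕ} {R : Finset (E d)} (hR0 : ∀ α ∈ R, α ≠ 0)
    (hRrefl : ∀ α ∈ R, ∀ β ∈ R, dunklReflect α β ∈ R) {k : E d → ℝ} (hkpos : ∀ α ∈ R, 0 < k α)
    (hkinv : ∀ α ∈ R, ∀ β ∈ R, k (dunklReflect α β) = k β) {p ψ : E d → ℝ} (hp : ContDiff ℝ 2 p)
    (hψ : ContDiff ℝ 2 ψ) (hψc : HasCompactSupport ψ) :
    ∫ x, (p x * dunklLap R k ψ x - ψ x * dunklLap R k p x) * wk R k x = 0 := by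
  set e : Fin d → E d := fun i => EuclideanSpace.single i 1 with he
  set F : Fin d → E d → ℝ := fun i x => p x * fderiv ℝ ψ x (e i) - ψ x * fderiv ℝ p x (e i) with hF
  have hp1 : ContDiff ℝ 1 p := hp.of_le (by norm_num)
  have hψ1 : ContDiff ℝ 1 ψ := hψ.of_le (by norm_num)
  have hFd : ∀ i, ContDiff ℝ 1 (F i) := fun i =>
    (hp1.mul (contDiff_fderiv_apply hψ _)).sub (hψ1.mul (contDiff_fderiv_apply hp _))
  have hFs : ∀ i, HasCompactSupport (F i) := fun i =>
    ((hψc.fderiv_apply ℝ (e i)).mul_left).sub hψc.mul_right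
  have hF' : ∀ i x, fderiv ℝ (F i) x (e i) =
      p x * fderiv ℝ (fun y => fderiv ℝ ψ y (e i)) x (e i) -
        ψ x * fderiv ℝ (fun y => fderiv ℝ p y (e i)) x (e i) := by
    intro i x
    have h1 : DifferentiableAt ℝ p x := (hp1.differentiable one_ne_zero).differentiableAt
    have h2 : DifferentiableAt ℝ ψ x := (hψ1.differentiable one_ne_zero).differentiableAt
    have h3 := (differentiable_fderiv_apply hψ (e i)).differentiableAt (x := x)
    have h4 := (differentiable_fderiv_apply hp (e i)).differentiableAt (x := x)
    have h5 := ((h1.hasFDerivAt.mul h3.hasFDerivAt).sub (h2.hasFDerivAt.mul h4.hasFDerivAt)).fderiv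
    have h6 : F i = (p * fun y => fderiv ℝ ψ y (e i)) - (ψ * fun y => fderiv ℝ p y (e i)) := rfl
    rw [h6, h5]
    simp only [sub_apply, add_apply, smul_apply, smul_eq_mul]
    ring
  have hFα : ∀ α x, ∑ i, ⟪α, e i⟫ * F i x = p x * fderiv ℝ ψ x α - ψ x * fderiv ℝ p x α := by
    intro α x
    rw [← sum_inner_mul_fderiv ψ x α, ← sum_inner_mul_fderiv p x α, Finset.mul_sum, Finset.mul_sum,
      ← Finset.sum_sub_distrib]
    refine Finset.sum_congr rfl fun i _ => ?_
    simp only [hF, he]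
    ring
  have hsplit : ∀ x, (p x * dunklLap R k ψ x - ψ x * dunklLap R k p x) * wk R k x =
      (∑ i, (fderiv ℝ (F i) x (e i) * wk R k x +
        ∑ α ∈ R, k α * ⟪α, e i⟫ * (F i x / ⟪α, x⟫ * wk R k x))) -
      ∑ α ∈ R, k α * (‖α‖ ^ 2 / 2) *
        ((ψ x * p (dunklReflect α x) - p x * ψ (dunklReflect α x)) / ⟪α, x⟫ ^ 2 * wk R k x) := by
    intro x
    have h1 : ∑ i, ∑ α ∈ R, k α * ⟪α, e i⟫ * (F i x / ⟪α, x⟫ * wk R k x) =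
        ∑ α ∈ R, k α * ((p x * fderiv ℝ ψ x α - ψ x * fderiv ℝ p x α) / ⟪α, x⟫) * wk R k x := by
      rw [Finset.sum_comm]
      refine Finset.sum_congr rfl fun α _ => ?_
      rw [← hFα, Finset.sum_div, Finset.mul_sum, Finset.sum_mul]
      refine Finset.sum_congr rfl fun i _ => ?_
      ring
    have h2 : ∑ i, fderiv ℝ (F i) x (e i) * wk R k x = (p x * lap ψ x - ψ x * lap p x) * wk R k x := by
      rw [← Finset.sum_mul, lap_eq hψ, lap_eq hp, Finset.mul_sum, Finset.mul_sum,
        ← Finset.sum_sub_distrib]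
      congr 1
      exact Finset.sum_congr rfl fun i _ => hF' i x
    rw [Finset.sum_add_distrib, h1, h2, add_sub_assoc, ← Finset.sum_sub_distrib, dunklLap_eq,
      dunklLap_eq, mul_add, mul_add, Finset.mul_sum, Finset.mul_sum, add_sub_add_comm,
      ← Finset.sum_sub_distrib, add_mul, Finset.sum_mul]
    congr 1
    refine Finset.sum_congr rfl fun α _ => ?_
    simp only [dunklTerm]
    ring
  have hi1 : ∀ i, Integrable fun x => fderiv ℝ (F i) x (e i) * wk R k x := fun i =>
    integrable_mul_wk hkpos (((hFd i).continuous_fderiv one_ne_zero).clm_apply continuous_const)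
      ((hFs i).fderiv_apply ℝ (e i))
  have hi2 : ∀ i, ∀ α ∈ R,
      Integrable fun x => k α * ⟪α, e i⟫ * (F i x / ⟪α, x⟫ * wk R k x) := fun i α hα =>
    (integrable_div_inner_mul_wk hR0 hkpos hα (hFd i).continuous (hFs i)).const_mul _
  have hi3 : ∀ α ∈ R, Integrable fun x => k α * (‖α‖ ^ 2 / 2) *
      ((ψ x * p (dunklReflect α x) - p x * ψ (dunklReflect α x)) / ⟪α, x⟫ ^ 2 * wk R k x) :=
    fun α hα => (integrable_reflection hR0 hkpos hα hp1 hψ1 hψc).const_mul _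
  have hi4 : ∀ i, Integrable fun x => fderiv ℝ (F i) x (e i) * wk R k x +
      ∑ α ∈ R, k α * ⟪α, e i⟫ * (F i x / ⟪α, x⟫ * wk R k x) := fun i =>
    (hi1 i).add (integrable_finsetSum _ (hi2 i))
  simp_rw [hsplit]
  rw [integral_sub (integrable_finsetSum _ fun i _ => hi4 i) (integrable_finsetSum _ hi3),
    integral_finsetSum _ fun i _ => hi4 i, integral_finsetSum _ hi3]
  rw [Finset.sum_eq_zero fun i _ => ?_, Finset.sum_eq_zero fun α hα => ?_, sub_zero]
  · rw [integral_const_mul, integral_reflection_eq_zero hR0 hRrefl hkinv hα, mul_zero]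
  · rw [integral_add (hi1 i) (integrable_finsetSum _ (hi2 i)), integral_finsetSum _ (hi2 i)]
    simp_rw [integral_const_mul]
    rw [sum_integral_div_inner_mul_wk hR0 hkpos (hFd i) (hFs i), add_neg_cancel]

lemma setIntegral_mul_dunklLap_comm {d : ℕ} {R : Finset (E d)} (hR0 : ∀ α ∈ R, α ≠ 0)
    (hRrefl : ∀ α ∈ R, ∀ β ∈ R, dunklReflect α β ∈ R) {k : E d → ℝ} (hkpos : ∀ α ∈ R, 0 < k α)
    (hkinv : ∀ α ∈ R, ∀ β ∈ R, k (dunklReflect α β) = k β) {p ψ : E d → ℝ} (hp : ContDiff ℝ 2 p)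
    (hψ : ContDiff ℝ 2 ψ) (hψc : HasCompactSupport ψ) {r : ℝ}
    (hsub : tsupport ψ ⊆ Metric.ball 0 r) :
    ∫ x in Metric.ball 0 r, p x * dunklLap R k ψ x * wk R k x =
      ∫ x in Metric.ball 0 r, dunklLap R k p x * ψ x * wk R k x := by
  have h1 := (integrableOn_mul_dunklLap_mul_wk hR0 hkpos hψ (r := r)
    hp.continuous.continuousOn).mono_set Metric.ball_subset_closedBall
  have h2 := (integrableOn_mul_dunklLap_mul_wk hR0 hkpos hp (r := r)
    hψ.continuous.continuousOn).mono_set Metric.ball_subset_closedBall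
  have h := integral_mul_dunklLap_comm hR0 hRrefl hkpos hkinv hp hψ hψc
  rw [← setIntegral_eq_integral_of_forall_compl_eq_zero (s := Metric.ball 0 r)
    (fun x hx => ?_)] at h
  · simp_rw [sub_mul] at h
    rw [integral_sub h1 h2, sub_eq_zero] at h
    simp_rw [h, mul_comm (ψ _)]
  · rw [dunklLap_eq_zero_of_notMem hR0 k hψ hsub hx,
      image_eq_zero_of_notMem_tsupport fun h => hx (hsub h)]
    ring

lemma StrongPair.setIntegral_mul_dunklLap {d : ℕ} {R : Finset (E d)} (hR0 : ∀ α ∈ R, α ≠ 0)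
    (hRrefl : ∀ α ∈ R, ∀ β ∈ R, dunklReflect α β ∈ R) {k : E d → ℝ} (hkpos : ∀ α ∈ R, 0 < k α)
    (hkinv : ∀ α ∈ R, ∀ β ∈ R, k (dunklReflect α β) = k β) {r : ℝ} {v g : E d → ℝ}
    (h : StrongPair R k r v g) (hv : ContinuousOn v (Metric.closedBall 0 r))
    (hg : ContinuousOn g (Metric.closedBall 0 r)) {ψ : E d → ℝ}
    (hψ : ContDiff ℝ 2 ψ) (hψc : HasCompactSupport ψ) (hsub : tsupport ψ ⊆ Metric.ball 0 r) :
    ∫ x in Metric.ball 0 r, v x * dunklLap R k ψ x * wk R k x =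
      ∫ x in Metric.ball 0 r, g x * ψ x * wk R k x := by
  have hBK := Metric.ball_subset_closedBall (x := (0 : E d)) (ε := r)
  have hi1 : ∀ {w : E d → ℝ}, ContinuousOn w (Metric.closedBall 0 r) →
      IntegrableOn (fun x => w x * dunklLap R k ψ x * wk R k x) (Metric.ball 0 r) := fun hw =>
    (integrableOn_mul_dunklLap_mul_wk hR0 hkpos hψ hw).mono_set hBK
  have hi2 : ∀ {w : E d → ℝ}, ContinuousOn w (Metric.closedBall 0 r) →
      IntegrableOn (fun x => w x * ψ x * wk R k x) (Metric.ball 0 r) := fun hw =>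
    (((hw.mul hψ.continuous.continuousOn).mul (continuous_wk hkpos).continuousOn
      ).integrableOn_compact (isCompact_closedBall 0 r)).mono_set hBK
  set A := ∫ x in Metric.ball 0 r, |dunklLap R k ψ x * wk R k x| with hA
  set B := ∫ x in Metric.ball 0 r, |ψ x * wk R k x| with hB
  have hA0 : 0 ≤ A := integral_nonneg fun _ => abs_nonneg _
  have hB0 : 0 ≤ B := integral_nonneg fun _ => abs_nonneg _
  have hiA : IntegrableOn (fun x => |dunklLap R k ψ x * wk R k x|) (Metric.ball 0 r) :=
    ((integrableOn_dunklLap_mul_wk hR0 hkpos hψ r).mono_set hBK).abs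
  have hiB : IntegrableOn (fun x => |ψ x * wk R k x|) (Metric.ball 0 r) := by
    have h1 : IntegrableOn (fun x => ψ x * wk R k x) (Metric.ball 0 r) := by
      simpa using hi2 (w := fun _ => 1) continuousOn_const
    exact h1.abs
  have key : ∀ ε > 0, |∫ x in Metric.ball 0 r, v x * dunklLap R k ψ x * wk R k x -
      g x * ψ x * wk R k x| ≤ ε * (A + B) := by
    intro ε hε
    obtain ⟨p, P, hpP, hle⟩ := h ε hε
    have hpc : ContDiff ℝ 2 p := by
      obtain ⟨n, hn⟩ := hpP.1
      exact contDiff_of_mem_polyFun hn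
    have h1 := setIntegral_mul_dunklLap_comm hR0 hRrefl hkpos hkinv hpc hψ hψc hsub
    have h2 : ∫ x in Metric.ball 0 r, dunklLap R k p x * ψ x * wk R k x =
        ∫ x in Metric.ball 0 r, P x * ψ x * wk R k x := by
      refine integral_congr_ae (ae_restrict_of_ae ?_)
      filter_upwards [ae_offWalls hR0] with x hx
      rw [hpP.2.2 x hx]
    have hip := hi1 (w := p) hpP.continuous_left.continuousOn
    have hiP := hi2 (w := P) hpP.continuous_right.continuousOn
    have h3 : ∫ x in Metric.ball 0 r, (v x * dunklLap R k ψ x * wk R k x - g x * ψ x * wk R k x) =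
        ∫ x in Metric.ball 0 r, ((v x - p x) * (dunklLap R k ψ x * wk R k x) -
          (g x - P x) * (ψ x * wk R k x)) := by
      have h4 : ∀ x, (v x - p x) * (dunklLap R k ψ x * wk R k x) - (g x - P x) * (ψ x * wk R k x) =
          (v x * dunklLap R k ψ x * wk R k x - g x * ψ x * wk R k x) -
          (p x * dunklLap R k ψ x * wk R k x - P x * ψ x * wk R k x) := fun x => by ring
      have h7 : IntegrableOn (fun x => v x * dunklLap R k ψ x * wk R k x - g x * ψ x * wk R k x)
        (Metric.ball 0 r) := (hi1 hv).sub (hi2 hg)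
      have h8 : IntegrableOn (fun x => p x * dunklLap R k ψ x * wk R k x - P x * ψ x * wk R k x)
        (Metric.ball 0 r) := hip.sub hiP
      simp_rw [h4]
      rw [integral_sub h7 h8, integral_sub hip hiP, h1, h2,
        sub_self, sub_zero]
    rw [h3, mul_add, hA, hB, ← integral_const_mul, ← integral_const_mul,
      ← integral_add (hiA.const_mul ε) (hiB.const_mul ε), ← Real.norm_eq_abs]
    refine norm_integral_le_of_norm_le ((hiA.const_mul ε).add (hiB.const_mul ε)) ?_
    filter_upwards [ae_restrict_mem measurableSet_ball] with x hx
    obtain ⟨h5, h6⟩ := hle x (hBK hx)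
    rw [Real.norm_eq_abs]
    refine (abs_sub _ _).trans (add_le_add ?_ ?_)
    · rw [abs_mul]
      gcongr
    · rw [abs_mul]
      gcongr
  have h0 : |∫ x in Metric.ball 0 r, v x * dunklLap R k ψ x * wk R k x -
      g x * ψ x * wk R k x| ≤ 0 := by
    refine le_of_forall_pos_le_add fun δ hδ => ?_
    refine (key (δ / (A + B + 1)) (by positivity)).trans ?_
    rw [zero_add, div_mul_eq_mul_div, div_le_iff₀ (by positivity)]
    nlinarith
  rw [integral_sub (hi1 hv) (hi2 hg)] at h0
  exact sub_eq_zero.1 (abs_eq_zero.1 (le_antisymm h0 (abs_nonneg _)))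

lemma volume_real_ball_diff_ball_le {d : ℕ} {r : ℝ} (hr : 0 < r) {δ : ℝ} (hδ0 : 0 ≤ δ)
    (hδ1 : δ < 1) :
    volume.real (Metric.ball (0 : E d) r \ Metric.ball 0 (r * (1 - δ))) ≤
      r ^ d * d * volume.real (Metric.ball (0 : E d) 1) * δ := by
  have h1 : 0 < r * (1 - δ) := mul_pos hr (by linarith)
  have h2 : Metric.ball (0 : E d) (r * (1 - δ)) ⊆ Metric.ball 0 r :=
    Metric.ball_subset_ball (by nlinarith)
  have hpow : 1 - d * δ ≤ (1 - δ) ^ d := by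
    have := one_add_mul_le_pow (a := -δ) (by linarith) d
    rw [sub_eq_add_neg 1 δ]
    linarith
  have hball : ∀ s > 0, volume.real (Metric.ball (0 : E d) s) =
      s ^ d * volume.real (Metric.ball (0 : E d) 1) := by
    intro s hs
    rw [measureReal_def, Measure.addHaar_ball_of_pos _ _ hs, ENNReal.toReal_mul,
      ENNReal.toReal_ofReal (by positivity), finrank_euclideanSpace_fin, measureReal_def]
  rw [measureReal_sdiff h2 measurableSet_ball, hball _ hr, hball _ h1, mul_pow]
  have h3 : 0 ≤ r ^ d * volume.real (Metric.ball (0 : E d) 1) := by positivity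
  nlinarith [mul_le_mul_of_nonneg_left hpow h3]

lemma exists_abs_le_of_eq_zero_on_sphere {d : ℕ} {r : ℝ} (hr : 0 < r) {h : E d → ℝ}
    (hh : ContinuousOn h (Metric.closedBall 0 r)) (h0 : ∀ x ∈ Metric.sphere (0 : E d) r, h x = 0)
    {η : ℝ} (hη : 0 < η) :
    ∃ δ > 0, δ < 1 ∧ ∀ x ∈ Metric.ball (0 : E d) r, r * (1 - δ) < ‖x‖ → |h x| ≤ η := by
  obtain ⟨δ, hδ, H⟩ := Metric.uniformContinuousOn_iff.1
    ((isCompact_closedBall _ _).uniformContinuousOn_of_continuous hh) η hη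
  refine ⟨min (δ / r) (1 / 2), by positivity, (min_le_right _ _).trans_lt (by norm_num),
    fun x hx hlt => ?_⟩
  have hxr : ‖x‖ < r := by simpa using hx
  have h1 : r * min (δ / r) (1 / 2) ≤ δ := by
    calc _ ≤ r * (δ / r) := mul_le_mul_of_nonneg_left (min_le_left _ _) hr.le
      _ = δ := by field_simp
  have h2 : r * min (δ / r) (1 / 2) ≤ r * (1 / 2) :=
    mul_le_mul_of_nonneg_left (min_le_right _ _) hr.le
  have hx0 : 0 < ‖x‖ := by linarith
  have hy : ‖(r / ‖x‖) • x‖ = r := by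
    rw [norm_smul, Real.norm_of_nonneg (by positivity)]
    field_simp
  have hd : dist x ((r / ‖x‖) • x) < δ := by
    have : x - (r / ‖x‖) • x = (1 - r / ‖x‖) • x := by rw [sub_smul, one_smul]
    rw [dist_eq_norm, this, norm_smul, Real.norm_eq_abs, abs_sub_comm, abs_of_nonneg, sub_mul,
      div_mul_cancel₀ _ hx0.ne']
    · linarith
    · rw [sub_nonneg, one_le_div hx0]
      exact hxr.le
  have h3 := H x (Metric.ball_subset_closedBall hx) ((r / ‖x‖) • x)
    (by rw [mem_closedBall_zero_iff, hy]) hd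
  rw [h0 ((r / ‖x‖) • x) (by rw [mem_sphere_zero_iff_norm, hy]), dist_zero_right] at h3
  exact h3.le

/-- A smooth function equal to `-y` for `y ≤ 1` and to `0` for `2 ≤ y`. -/
def layerCutoff (y : ℝ) : ℝ := (Real.smoothTransition (y - 1) - 1) * y

lemma contDiff_layerCutoff {n : WithTop ℕ∞} (hn : n ≤ (⊤ : ℕ∞)) : ContDiff ℝ n layerCutoff := by
  have h : ContDiff ℝ (⊤ : ℕ∞) Real.smoothTransition := Real.smoothTransition.contDiff
  exact (((h.comp (contDiff_id.sub contDiff_const)).sub contDiff_const).mul contDiff_id).of_le hn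

lemma layerCutoff_of_le_one {y : ℝ} (hy : y ≤ 1) : layerCutoff y = -y := by
  rw [layerCutoff, Real.smoothTransition.zero_of_nonpos (by linarith)]
  ring

lemma layerCutoff_of_two_le {y : ℝ} (hy : 2 ≤ y) : layerCutoff y = 0 := by
  rw [layerCutoff, Real.smoothTransition.one_of_one_le (by linarith)]
  ring

lemma deriv_scaled_layerCutoff {ε : ℝ} (hε : 0 < ε) (a : ℝ) :
    deriv (fun s => ε * layerCutoff ((a - s) / ε)) =
      fun s => -deriv layerCutoff ((a - s) / ε) := by
  funext s
  have h1 : HasDerivAt (fun s => (a - s) / ε) (-1 / ε) s :=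
    ((hasDerivAt_id s).const_sub a).div_const ε
  have hZ : DifferentiableAt ℝ layerCutoff ((a - s) / ε) :=
    ((contDiff_layerCutoff (n := 1) (by exact_mod_cast le_top)).differentiable
      one_ne_zero).differentiableAt
  have h2 := ((hZ.hasDerivAt.comp s h1).const_mul ε).deriv
  simp only [Function.comp_def] at h2
  rw [h2]
  field_simp

lemma deriv_deriv_scaled_layerCutoff {ε : ℝ} (hε : 0 < ε) (a : ℝ) :
    deriv (deriv fun s => ε * layerCutoff ((a - s) / ε)) =
      fun s => deriv (deriv layerCutoff) ((a - s) / ε) / ε := by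
  rw [deriv_scaled_layerCutoff hε]
  funext s
  have h1 : HasDerivAt (fun s => (a - s) / ε) (-1 / ε) s :=
    ((hasDerivAt_id s).const_sub a).div_const ε
  have hZ : DifferentiableAt ℝ (deriv layerCutoff) ((a - s) / ε) :=
    (((contDiff_layerCutoff (n := 1 + 1) (by norm_cast)).deriv').differentiable
      one_ne_zero).differentiableAt
  have h2 := ((hZ.hasDerivAt.comp s h1).neg).deriv
  simp only [Function.comp_def] at h2
  refine h2.trans ?_
  field_simp

lemma exists_testFunction_of_polyFun {d : ℕ} {R : Finset (E d)} (hR0 : ∀ α ∈ R, α ≠ 0)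
    {k : E d → ℝ} (hkpos : ∀ α ∈ R, 0 < k α) (hm : 2 < (d : ℝ) + ∑ α ∈ R, k α) {r : ℝ} (hr : 0 < r)
    {n : ℕ} {p : E d → ℝ} (hp : p ∈ polyFun d n) :
    ∃ C ≥ 0, ∀ δ > 0, δ < 1 / 2 → ∃ ψ : E d → ℝ, ContDiff ℝ (⊤ : ℕ∞) ψ ∧ HasCompactSupport ψ ∧
      tsupport ψ ⊆ Metric.ball 0 r ∧ ∀ x ∈ offWalls R, x ∈ Metric.ball (0 : E d) r →
        |dunklLap R k ψ x - p x| ≤ C / δ ∧ (‖x‖ ≤ r * (1 - 2 * δ) → dunklLap R k ψ x = p x) := by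
  obtain ⟨q, hq, hqp⟩ := exists_poisson_poly hR0 hkpos hm hr hp
  obtain ⟨Q, hQ, hqQ⟩ := exists_dunklLap_mem_polyFun hR0 k hq
  have hq2 : ContDiff ℝ 2 q := contDiff_of_mem_polyFun hq
  have hq1 : ContDiff ℝ 1 q := contDiff_of_mem_polyFun hq
  have hqs : ContDiff ℝ (⊤ : ℕ∞) q := contDiff_of_mem_polyFun hq
  have hQc : Continuous Q := (contDiff_of_mem_polyFun (m := 0) hQ).continuous
  have hK := isCompact_closedBall (0 : E d) r
  obtain ⟨c₀, h₀⟩ := hK.exists_bound_of_continuousOn hq1.continuous.continuousOn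
  obtain ⟨c₁, h₁⟩ := hK.exists_bound_of_continuousOn
    ((hq1.continuous_fderiv one_ne_zero).clm_apply continuous_id).continuousOn
  obtain ⟨c₂, h₂⟩ := hK.exists_bound_of_continuousOn hQc.continuousOn
  have hZ2 : ContDiff ℝ (1 + 1) layerCutoff :=
    contDiff_layerCutoff (by norm_cast)
  obtain ⟨M₀, g₀⟩ := isCompact_Icc.exists_bound_of_continuousOn (s := Set.Icc (0 : ℝ) 2)
    hZ2.continuous.continuousOn
  obtain ⟨M₁, g₁⟩ := isCompact_Icc.exists_bound_of_continuousOn (s := Set.Icc (0 : ℝ) 2)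
    hZ2.deriv'.continuous.continuousOn
  obtain ⟨M₂, g₂⟩ := isCompact_Icc.exists_bound_of_continuousOn (s := Set.Icc (0 : ℝ) 2)
    (hZ2.deriv'.continuous_deriv le_rfl).continuousOn
  have h0K : (0 : E d) ∈ Metric.closedBall (0 : E d) r := Metric.mem_closedBall_self hr.le
  have h0I : (0 : ℝ) ∈ Set.Icc (0 : ℝ) 2 := by simp
  have hc₀ := (norm_nonneg _).trans (h₀ 0 h0K)
  have hc₁ := (norm_nonneg _).trans (h₁ 0 h0K)
  have hc₂ := (norm_nonneg _).trans (h₂ 0 h0K)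
  have hM₀ := (norm_nonneg _).trans (g₀ 0 h0I)
  have hM₁ := (norm_nonneg _).trans (g₁ 0 h0I)
  have hM₂ := (norm_nonneg _).trans (g₂ 0 h0I)
  set m := (d : ℝ) + ∑ α ∈ R, k α with hmdef
  have hm0 : 0 ≤ m := by linarith
  refine ⟨r ^ 2 * M₀ * c₂ + 4 * M₁ * c₁ + c₀ * (4 * M₂ + 2 * m * M₁), by positivity,
    fun δ hδ hδ2 => ?_⟩
  set ε := r ^ 2 * δ with hεdef
  have hε : 0 < ε := by positivity
  set G : ℝ → ℝ := fun s => ε * layerCutoff ((r ^ 2 - s) / ε) with hG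
  have hGs : ContDiff ℝ (⊤ : ℕ∞) G := contDiff_const.mul ((contDiff_layerCutoff le_rfl).comp
    ((contDiff_const.sub contDiff_id).div_const ε))
  have hG2 : ContDiff ℝ 2 G := hGs.of_le (by norm_cast)
  have hns : ContDiff ℝ (⊤ : ℕ∞) fun x : E d => ‖x‖ ^ 2 := contDiff_norm_sq ℝ
  have hρs : ContDiff ℝ (⊤ : ℕ∞) fun x : E d => (r ^ 2 - ‖x‖ ^ 2) * q x :=
    (contDiff_const.sub hns).mul hqs
  have hGq : ContDiff ℝ (⊤ : ℕ∞) fun x : E d => G (‖x‖ ^ 2) * q x := (hGs.comp hns).mul hqs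
  set ψ : E d → ℝ := fun x => (r ^ 2 - ‖x‖ ^ 2) * q x + G (‖x‖ ^ 2) * q x with hψ
  have hts : tsupport ψ ⊆ {x | ε ≤ r ^ 2 - ‖x‖ ^ 2} := by
    refine closure_minimal (fun x hx => ?_) (isClosed_le continuous_const (by fun_prop))
    by_contra hlt
    rw [Set.mem_ofPred_eq, not_le] at hlt
    refine hx ?_
    simp only [hψ, hG]
    rw [layerCutoff_of_le_one ((div_le_one hε).2 hlt.le)]
    field_simp
    ring
  have htb : tsupport ψ ⊆ Metric.ball 0 r := fun x hx => by
    have := hts hx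
    rw [Set.mem_ofPred_eq] at this
    rw [mem_ball_zero_iff]
    exact lt_of_pow_lt_pow_left₀ 2 hr.le (by linarith)
  refine ⟨ψ, hρs.add hGq, HasCompactSupport.intro' hK Metric.isClosed_closedBall fun x hx =>
    image_eq_zero_of_notMem_tsupport fun h => hx (Metric.ball_subset_closedBall (htb h)), htb,
    fun x hx hxb => ?_⟩
  have hdiff : dunklLap R k ψ x - p x = dunklLap R k (fun y => G (‖y‖ ^ 2) * q y) x := by
    rw [hψ, dunklLap_add R k (hρs.of_le (by norm_cast))
      (hGq.of_le (by norm_cast)), hqp.2.2 x hx]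
    ring
  have hxr : ‖x‖ < r := by simpa using hxb
  have hxK := Metric.ball_subset_closedBall hxb
  have hzero : 2 < (r ^ 2 - ‖x‖ ^ 2) / ε → dunklLap R k ψ x - p x = 0 := by
    intro hy
    have hev : G =ᶠ[𝓝 (‖x‖ ^ 2)] fun _ => 0 := by
      have : ContinuousAt (fun s => (r ^ 2 - s) / ε) (‖x‖ ^ 2) := by fun_prop
      filter_upwards [this.eventually (lt_mem_nhds hy)] with s hs
      simp only [hG]
      rw [layerCutoff_of_two_le hs.le, mul_zero]
    rw [hdiff, dunklLap_radial_mul hR0 k hG2 hq2 hx, hev.eq_of_nhds, hev.deriv_eq,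
      hev.deriv.deriv_eq]
    simp
  refine ⟨?_, fun hle => sub_eq_zero.1 (hzero ?_)⟩
  · by_cases hy : 2 < (r ^ 2 - ‖x‖ ^ 2) / ε
    · rw [hzero hy, abs_zero]
      positivity
    have hyI : (r ^ 2 - ‖x‖ ^ 2) / ε ∈ Set.Icc (0 : ℝ) 2 :=
      ⟨div_nonneg (by nlinarith [norm_nonneg x]) hε.le, not_lt.1 hy⟩
    have e₀ := h₀ x hxK
    have e₁ := h₁ x hxK
    have e₂ := h₂ x hxK
    have f₀ := g₀ _ hyI
    have f₁ := g₁ _ hyI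
    have f₂ := g₂ _ hyI
    simp only [Real.norm_eq_abs, id] at e₀ e₁ e₂ f₀ f₁ f₂
    rw [hdiff, dunklLap_radial_mul hR0 k hG2 hq2 hx, hqQ x hx, hG,
      deriv_deriv_scaled_layerCutoff hε, deriv_scaled_layerCutoff hε]
    simp only
    set y := (r ^ 2 - ‖x‖ ^ 2) / ε
    have hδ1 : δ ≤ 1 := by linarith
    have k₀ : |ε * layerCutoff y * Q x| ≤ r ^ 2 * M₀ * c₂ / δ := by
      rw [abs_mul, abs_mul, abs_of_pos hε]
      calc ε * |layerCutoff y| * |Q x| ≤ ε * M₀ * c₂ := by gcongr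
        _ = r ^ 2 * M₀ * c₂ * δ := by rw [hεdef]; ring
        _ ≤ r ^ 2 * M₀ * c₂ / δ := by
          rw [le_div_iff₀ hδ, mul_assoc]
          exact mul_le_of_le_one_right (by positivity) (by nlinarith)
    have k₁ : |4 * -deriv layerCutoff y * fderiv ℝ q x x| ≤ 4 * M₁ * c₁ / δ := by
      rw [abs_mul, abs_mul, abs_neg, abs_of_pos (four_pos : (0 : ℝ) < 4)]
      calc 4 * |deriv layerCutoff y| * |fderiv ℝ q x x| ≤ 4 * M₁ * c₁ := by gcongr
        _ ≤ 4 * M₁ * c₁ / δ := le_div_self (by positivity) hδ hδ1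
    have k₂ : |4 * ‖x‖ ^ 2 * (deriv (deriv layerCutoff) y / ε)| ≤ 4 * M₂ / δ := by
      rw [abs_mul, abs_div, abs_of_pos hε, abs_of_nonneg (by positivity)]
      calc 4 * ‖x‖ ^ 2 * (|deriv (deriv layerCutoff) y| / ε) ≤ 4 * r ^ 2 * (M₂ / ε) := by gcongr
        _ = 4 * M₂ / δ := by rw [hεdef]; field_simp
    have k₃ : |2 * m * -deriv layerCutoff y| ≤ 2 * m * M₁ / δ := by
      rw [abs_mul, abs_neg, abs_of_nonneg (by positivity)]
      calc 2 * m * |deriv layerCutoff y| ≤ 2 * m * M₁ := by gcongr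
        _ ≤ 2 * m * M₁ / δ := le_div_self (by positivity) hδ hδ1
    have k₄ : |q x * (4 * ‖x‖ ^ 2 * (deriv (deriv layerCutoff) y / ε) +
        2 * m * -deriv layerCutoff y)| ≤ c₀ * (4 * M₂ / δ + 2 * m * M₁ / δ) := by
      rw [abs_mul]
      exact mul_le_mul e₀ ((abs_add_le _ _).trans (add_le_add k₂ k₃)) (abs_nonneg _) hc₀
    refine (abs_add_le _ _).trans ((add_le_add ((abs_add_le _ _).trans (add_le_add k₀ k₁))
      k₄).trans_eq ?_)
    ring
  · rw [lt_div_iff₀ hε, hεdef]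
    have h3 : ‖x‖ ^ 2 ≤ (r * (1 - 2 * δ)) ^ 2 := pow_le_pow_left₀ (norm_nonneg x) hle 2
    have h4 : 0 < r ^ 2 * (δ * (1 - 2 * δ)) :=
      mul_pos (by positivity) (mul_pos hδ (by linarith))
    nlinarith

lemma setIntegral_mul_polyFun_eq_zero {d : ℕ} {R : Finset (E d)} (hR0 : ∀ α ∈ R, α ≠ 0)
    {k : E d → ℝ} (hkpos : ∀ α ∈ R, 0 < k α) (hm : 2 < (d : ℝ) + ∑ α ∈ R, k α) {r : ℝ} (hr : 0 < r)
    {h : E d → ℝ} (hh : ContinuousOn h (Metric.closedBall 0 r))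
    (h0 : ∀ x ∈ Metric.sphere (0 : E d) r, h x = 0)
    (hweak : ∀ ψ : E d → ℝ, ContDiff ℝ (⊤ : ℕ∞) ψ → HasCompactSupport ψ →
      tsupport ψ ⊆ Metric.ball 0 r → ∫ x in Metric.ball 0 r, h x * dunklLap R k ψ x * wk R k x = 0)
    {n : ℕ} {p : E d → ℝ} (hp : p ∈ polyFun d n) :
    ∫ x in Metric.ball 0 r, h x * p x * wk R k x = 0 := by
  have hK := isCompact_closedBall (0 : E d) r
  have hBK := Metric.ball_subset_closedBall (x := (0 : E d)) (ε := r)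
  obtain ⟨C, hC, H⟩ := exists_testFunction_of_polyFun hR0 hkpos hm hr hp
  obtain ⟨W, hW⟩ := hK.exists_bound_of_continuousOn (continuous_wk hkpos (R := R)).continuousOn
  have hW0 := (norm_nonneg _).trans (hW 0 (Metric.mem_closedBall_self hr.le))
  set V := r ^ d * d * volume.real (Metric.ball (0 : E d) 1) with hV
  have hV0 : 0 ≤ V := by positivity
  have hpc : Continuous p := (contDiff_of_mem_polyFun (m := 0) hp).continuous
  have hip : IntegrableOn (fun x => h x * p x * wk R k x) (Metric.ball 0 r) :=
    (((hh.mul hpc.continuousOn).mul (continuous_wk hkpos).continuousOn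
      ).integrableOn_compact hK).mono_set hBK
  have key : ∀ η > 0, |∫ x in Metric.ball 0 r, h x * p x * wk R k x| ≤ η * (C * W * V * 2) := by
    intro η hη
    obtain ⟨δ₀, hδ₀, hδ₁, hle⟩ := exists_abs_le_of_eq_zero_on_sphere hr hh h0 hη
    set δ := δ₀ / 4 with hδ
    have hδpos : 0 < δ := by positivity
    obtain ⟨ψ, hψ, hψc, hsub, hψp⟩ := H δ hδpos (by linarith)
    have hiψ : IntegrableOn (fun x => h x * dunklLap R k ψ x * wk R k x) (Metric.ball 0 r) :=
      (integrableOn_mul_dunklLap_mul_wk hR0 hkpos (hψ.of_le (by norm_cast)) hh).mono_set hBK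
    have h1 : ∫ x in Metric.ball 0 r, h x * p x * wk R k x =
        ∫ x in Metric.ball 0 r, (h x * p x * wk R k x - h x * dunklLap R k ψ x * wk R k x) := by
      rw [integral_sub hip hiψ, hweak ψ hψ hψc hsub, sub_zero]
    have h2 : ∫ x in Metric.ball 0 r, (h x * p x * wk R k x - h x * dunklLap R k ψ x * wk R k x) =
        ∫ x in Metric.ball 0 r \ Metric.ball 0 (r * (1 - 2 * δ)),
          (h x * p x * wk R k x - h x * dunklLap R k ψ x * wk R k x) := by
      refine setIntegral_eq_of_subset_of_ae_sdiff_eq_zero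
        measurableSet_ball.nullMeasurableSet Set.sdiff_subset ?_
      filter_upwards [ae_offWalls hR0] with x hx hxm
      have hxr : ‖x‖ < r * (1 - 2 * δ) := by
        have := not_not.1 fun hn => hxm.2 ⟨hxm.1, hn⟩
        simpa using this
      rw [(hψp x hx hxm.1).2 hxr.le, sub_self]
    rw [h1, h2, ← Real.norm_eq_abs]
    refine (norm_setIntegral_le_of_norm_le_const_ae' (C := η * (C / δ) * W)
      ((measure_mono Set.sdiff_subset).trans_lt measure_ball_lt_top) ?_).trans ?_
    · filter_upwards [ae_offWalls hR0] with x hx hxm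
      have hxr : r * (1 - 2 * δ) ≤ ‖x‖ := by simpa using hxm.2
      have h3 := hle x hxm.1 (lt_of_lt_of_le (by nlinarith) hxr)
      have h4 := (hψp x hx hxm.1).1
      rw [abs_sub_comm] at h4
      rw [← sub_mul, ← mul_sub, norm_mul, norm_mul]
      exact mul_le_mul (mul_le_mul h3 h4 (norm_nonneg _) hη.le) (hW x (hBK hxm.1)) (norm_nonneg _)
        (by positivity)
    · calc _ ≤ η * (C / δ) * W * (V * (2 * δ)) := by
            gcongr
            exact volume_real_ball_diff_ball_le hr (by positivity) (by linarith)
        _ = η * (C * W * V * 2) := by field_simp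
  refine abs_eq_zero.1 (le_antisymm (le_of_forall_pos_le_add fun η hη => ?_) (abs_nonneg _))
  refine (key (η / (C * W * V * 2 + 1)) (by positivity)).trans ?_
  rw [zero_add, div_mul_eq_mul_div, div_le_iff₀ (by positivity)]
  nlinarith

lemma eqOn_zero_of_weakly_harmonic {d : ℕ} {R : Finset (E d)} (hR0 : ∀ α ∈ R, α ≠ 0)
    {k : E d → ℝ} (hkpos : ∀ α ∈ R, 0 < k α) (hm : 2 < (d : ℝ) + ∑ α ∈ R, k α) {r : ℝ} (hr : 0 < r)
    {h : E d → ℝ} (hh : ContinuousOn h (Metric.closedBall 0 r))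
    (h0 : ∀ x ∈ Metric.sphere (0 : E d) r, h x = 0)
    (hweak : ∀ ψ : E d → ℝ, ContDiff ℝ (⊤ : ℕ∞) ψ → HasCompactSupport ψ →
      tsupport ψ ⊆ Metric.ball 0 r → ∫ x in Metric.ball 0 r, h x * dunklLap R k ψ x * wk R k x = 0) :
    ∀ x ∈ Metric.closedBall (0 : E d) r, h x = 0 := by
  have hK := isCompact_closedBall (0 : E d) r
  have hBK := Metric.ball_subset_closedBall (x := (0 : E d)) (ε := r)
  obtain ⟨h', hh', heq⟩ := exists_continuous_eqOn Metric.isClosed_closedBall hh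
  have hwc : Continuous (wk R k) := continuous_wk hkpos
  have hi : ∀ {w : E d → ℝ}, ContinuousOn w (Metric.closedBall 0 r) →
      IntegrableOn (fun x => h x * w x * wk R k x) (Metric.ball 0 r) := fun hw =>
    (((hh.mul hw).mul hwc.continuousOn).integrableOn_compact hK).mono_set hBK
  set A := ∫ x in Metric.ball 0 r, |h x * wk R k x| with hA
  have hA0 : 0 ≤ A := integral_nonneg fun _ => abs_nonneg _
  have hiA : IntegrableOn (fun x => |h x * wk R k x|) (Metric.ball 0 r) :=
    (((hh.mul hwc.continuousOn).integrableOn_compact hK).mono_set hBK).abs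
  have hnn : ∀ x, 0 ≤ h x * h x * wk R k x := fun x =>
    mul_nonneg (mul_self_nonneg _) (wk_nonneg R k x)
  have key : ∀ ε > 0, ∫ x in Metric.ball 0 r, h x * h x * wk R k x ≤ ε * A := by
    intro ε hε
    obtain ⟨n, p, hp, hle⟩ := exists_poly_approx r hh' hε
    have hpc : Continuous p := (contDiff_of_mem_polyFun (m := 0) hp).continuous
    have h1 := setIntegral_mul_polyFun_eq_zero hR0 hkpos hm hr hh h0 hweak hp
    calc ∫ x in Metric.ball 0 r, h x * h x * wk R k x
        = ∫ x in Metric.ball 0 r, (h x * h x * wk R k x - h x * p x * wk R k x) := by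
          rw [integral_sub (hi hh) (hi hpc.continuousOn), h1, sub_zero]
      _ ≤ ∫ x in Metric.ball 0 r, ε * |h x * wk R k x| := by
          refine setIntegral_mono_on ((hi hh).sub (hi hpc.continuousOn)) (hiA.const_mul ε)
            measurableSet_ball fun x hx => ?_
          have h2 := hle x (hBK hx)
          rw [heq x (hBK hx)] at h2
          calc _ = (h x - p x) * (h x * wk R k x) := by ring
            _ ≤ |(h x - p x) * (h x * wk R k x)| := le_abs_self _
            _ ≤ ε * |h x * wk R k x| := by
              rw [abs_mul]
              gcongr
      _ = ε * A := integral_const_mul _ _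
  have hint : ∫ x in Metric.ball 0 r, h x * h x * wk R k x = 0 := by
    refine le_antisymm (le_of_forall_pos_le_add fun η hη => ?_) (integral_nonneg hnn)
    refine (key (η / (A + 1)) (by positivity)).trans ?_
    rw [zero_add, div_mul_eq_mul_div, div_le_iff₀ (by positivity)]
    nlinarith
  have hae := (setIntegral_eq_zero_iff_of_nonneg_ae (ae_of_all _ hnn) (hi hh)).1 hint
  have hball : Set.EqOn h (fun _ => 0) (Metric.ball 0 r) := by
    refine Measure.eqOn_open_of_ae_eq (μ := volume) ?_ Metric.isOpen_ball (hh.mono hBK)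
      continuousOn_const
    filter_upwards [hae, ae_restrict_of_ae (ae_offWalls hR0)] with x hx hxw
    simpa [(wk_pos k hxw).ne'] using hx
  intro x hx
  rcases (mem_closedBall_zero_iff.1 hx).lt_or_eq with hlt | he
  · exact hball (mem_ball_zero_iff.2 hlt)
  · exact h0 x (mem_sphere_zero_iff_norm.2 he)

lemma StrongPair.of_weak {d : ℕ} {R : Finset (E d)} (hR0 : ∀ α ∈ R, α ≠ 0)
    (hRrefl : ∀ α ∈ R, ∀ β ∈ R, dunklReflect α β ∈ R) {k : E d → ℝ} (hkpos : ∀ α ∈ R, 0 < k α)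
    (hkinv : ∀ α ∈ R, ∀ β ∈ R, k (dunklReflect α β) = k β)
    (hm : 2 < (d : ℝ) + ∑ α ∈ R, k α) {r : ℝ} (hr : 0 < r) {v g : E d → ℝ}
    (hv : ContinuousOn v (Metric.closedBall 0 r)) (hg : ContinuousOn g (Metric.closedBall 0 r))
    (hweak : ∀ ψ : E d → ℝ, ContDiff ℝ (⊤ : ℕ∞) ψ → HasCompactSupport ψ →
      tsupport ψ ⊆ Metric.ball 0 r → ∫ x in Metric.ball 0 r, v x * dunklLap R k ψ x * wk R k x =
        ∫ x in Metric.ball 0 r, g x * ψ x * wk R k x) :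
    StrongPair R k r v g := by
  have hBK := Metric.ball_subset_closedBall (x := (0 : E d)) (ε := r)
  obtain ⟨v', hv', hvv⟩ := exists_continuous_eqOn Metric.isClosed_closedBall hv
  obtain ⟨g', hg', hgg⟩ := exists_continuous_eqOn Metric.isClosed_closedBall hg
  obtain ⟨w, hw, hwg, hwv⟩ := exists_strongPair hR0 hkpos hm hr hv' hg'
  have hwg' := hwg.congr (fun _ _ => rfl) hgg
  have hzero := eqOn_zero_of_weakly_harmonic hR0 hkpos hm hr (h := fun x => v x - w x)
    (hv.sub hw.continuousOn)
    (fun x hx => by rw [hwv x hx, hvv x (Metric.sphere_subset_closedBall hx), sub_self])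
    (fun ψ hψ hψc hsub => by
      have hψ2 : ContDiff ℝ 2 ψ := hψ.of_le (by norm_cast)
      have hi1 : IntegrableOn (fun x => v x * dunklLap R k ψ x * wk R k x) (Metric.ball 0 r) :=
        (integrableOn_mul_dunklLap_mul_wk hR0 hkpos hψ2 hv).mono_set hBK
      have hi2 : IntegrableOn (fun x => w x * dunklLap R k ψ x * wk R k x) (Metric.ball 0 r) :=
        (integrableOn_mul_dunklLap_mul_wk hR0 hkpos hψ2 hw.continuousOn).mono_set hBK
      simp_rw [sub_mul]
      rw [integral_sub hi1 hi2, hweak ψ hψ hψc hsub, hwg'.setIntegral_mul_dunklLap hR0 hRrefl hkpos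
        hkinv hw.continuousOn hg hψ2 hψc hsub, sub_self])
  exact hwg'.congr (fun x hx => (sub_eq_zero.1 (hzero x hx)).symm) fun _ _ => rfl

lemma le_of_isDunklSol {d : ℕ} {R : Finset (E d)} (hR0 : ∀ α ∈ R, α ≠ 0)
    (hRrefl : ∀ α ∈ R, ∀ β ∈ R, dunklReflect α β ∈ R) {k : E d → ℝ} (hkpos : ∀ α ∈ R, 0 < k α)
    (hkinv : ∀ α ∈ R, ∀ β ∈ R, k (dunklReflect α β) = k β)
    (hm : 2 < (d : ℝ) + ∑ α ∈ R, k α) {r : ℝ} (hr : 0 < r) {φ : ℝ → ℝ}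
    (hφmono : MonotoneOn φ (Set.Ici 0)) (hφc : ContinuousOn φ (Set.Ici 0)) {u₁ u₂ : E d → ℝ}
    (h₁ : ContinuousOn u₁ (Metric.closedBall 0 r)) (h₂ : ContinuousOn u₂ (Metric.closedBall 0 r))
    (hn₁ : ∀ x ∈ Metric.closedBall 0 r, 0 ≤ u₁ x) (hn₂ : ∀ x ∈ Metric.closedBall 0 r, 0 ≤ u₂ x)
    (hs : ∀ x ∈ Metric.sphere 0 r, u₁ x ≤ u₂ x)
    (hu₁ : IsDunklSol R k φ (Metric.ball 0 r) u₁) (hu₂ : IsDunklSol R k φ (Metric.ball 0 r) u₂) :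
    ∀ x ∈ Metric.closedBall 0 r, u₁ x ≤ u₂ x := by
  have hs₁ := StrongPair.of_weak hR0 hRrefl hkpos hkinv hm hr h₁ (hφc.comp h₁ hn₁) hu₁
  have hs₂ := StrongPair.of_weak hR0 hRrefl hkpos hkinv hm hr h₂ (hφc.comp h₂ hn₂) hu₂
  have h := (hs₁.sub hs₂).max_principle hR0 hkpos hm hr
    (fun x hx => sub_nonpos.2 (hs x hx)) fun x hx hlt => sub_nonneg.2 <|
      hφmono (hn₂ x (Metric.ball_subset_closedBall hx)) (hn₁ x (Metric.ball_subset_closedBall hx))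
        (sub_pos.1 hlt).le
  exact fun x hx => sub_nonpos.1 (h x hx)

/-- existence and uniqueness for the semilinear Dirichlet problem
Δ_k u = φ(u) in B, u = f on ∂B. -/
theorem dunkl_semilinear_dirichlet
    (d : ℕ) (hd : 1 ≤ d)
    (R : Finset (E d)) (hR0 : ∀ α ∈ R, α ≠ 0)
    (hRline : ∀ α ∈ R, (R : Set (E d)) ∩ {x | ∃ c : ℝ, x = c • α} = {α, -α})
    (hRrefl : ∀ α ∈ R, ∀ β ∈ R, dunklReflect α β ∈ R)
    (k : E d → ℝ) (hkpos : ∀ α ∈ R, 0 < k α)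
    (hkinv : ∀ α ∈ R, ∀ β ∈ R, k (dunklReflect α β) = k β)
    (hm : 2 < (d : ℝ) + ∑ α ∈ R, k α)
    (φ : ℝ → ℝ) (hφ0 : φ 0 = 0)
    (hφmono : MonotoneOn φ (Set.Ici 0))
    (hφnonneg : ∀ t : ℝ, 0 ≤ t → 0 ≤ φ t)
    (hφlip : ∀ x ∈ Set.Ici (0 : ℝ), ∃ K : NNReal, ∃ s ∈ nhdsWithin x (Set.Ici 0),
      LipschitzOnWith K φ s)
    (hφne : ∃ t : ℝ, 0 ≤ t ∧ φ t ≠ 0)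
    (r : ℝ) (hr : 0 < r)
    (f : E d → ℝ) (hf : ContinuousOn f (frontier (Metric.ball (0 : E d) r)))
    (hf0 : ∀ x ∈ frontier (Metric.ball (0 : E d) r), 0 ≤ f x) :
    (∃ u : E d → ℝ,
        ContinuousOn u (closure (Metric.ball (0 : E d) r)) ∧
        (∀ x ∈ closure (Metric.ball (0 : E d) r), 0 ≤ u x) ∧
        (∀ x ∈ frontier (Metric.ball (0 : E d) r), u x = f x) ∧
        IsDunklSol R k φ (Metric.ball 0 r) u) ∧
      (∀ u₁ u₂ : E d → ℝ,
        (ContinuousOn u₁ (closure (Metric.ball (0 : E d) r)) ∧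
          (∀ x ∈ closure (Metric.ball (0 : E d) r), 0 ≤ u₁ x) ∧
          (∀ x ∈ frontier (Metric.ball (0 : E d) r), u₁ x = f x) ∧
          IsDunklSol R k φ (Metric.ball 0 r) u₁) →
        (ContinuousOn u₂ (closure (Metric.ball (0 : E d) r)) ∧
          (∀ x ∈ closure (Metric.ball (0 : E d) r), 0 ≤ u₂ x) ∧
          (∀ x ∈ frontier (Metric.ball (0 : E d) r), u₂ x = f x) ∧
          IsDunklSol R k φ (Metric.ball 0 r) u₂) →
        Set.EqOn u₁ u₂ (closure (Metric.ball (0 : E d) r))) := by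
  have hφc : ContinuousOn φ (Set.Ici 0) := LocallyLipschitzOn.continuousOn hφlip
  rw [frontier_ball _ hr.ne'] at hf hf0 ⊢
  rw [closure_ball _ hr.ne']
  refine ⟨?_, fun u₁ u₂ ⟨hc₁, hn₁, hs₁, hu₁⟩ ⟨hc₂, hn₂, hs₂, hu₂⟩ x hx => le_antisymm ?_ ?_⟩
  · obtain ⟨f', hf', hff⟩ := exists_continuous_eqOn Metric.isClosed_sphere hf
    obtain ⟨u, hu, hstrong, hn, hs⟩ := exists_strongPair_semilinear hR0 hkpos hm hr hφ0 hφmono hφlip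
      hf' fun x hx => (hf0 x hx).trans_eq (hff x hx).symm
    exact ⟨u, hu.continuousOn, hn, fun x hx => (hs x hx).trans (hff x hx), fun ψ hψ hψc hsub =>
      hstrong.setIntegral_mul_dunklLap hR0 hRrefl hkpos hkinv hu.continuousOn
        (hφc.comp hu.continuousOn hn) (hψ.of_le (by norm_cast)) hψc hsub⟩
  · exact le_of_isDunklSol hR0 hRrefl hkpos hkinv hm hr hφmono hφc hc₁ hc₂ hn₁ hn₂
      (fun y hy => ((hs₁ y hy).trans (hs₂ y hy).symm).le) hu₁ hu₂ x hx
  · exact le_of_isDunklSol hR0 hRrefl hkpos hkinv hm hr hφmono hφc hc₂ hc₁ hn₂ hn₁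
      (fun y hy => ((hs₂ y hy).trans (hs₁ y hy).symm).le) hu₂ hu₁ x hx
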